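/- arXiv:2112.00630 — 2 statements merged into one kernel-verified Lean document; each statement's English description precedes it below -/
import Mathlib

section
/- Fix 0 < p ≤ 2 and let ℝ^{(ℕ)} be the additive group of finitely supported real sequences. Let φ : ℝ^{(ℕ)} → ℝ be a function radial with respect to ‖·‖_p^p (i.e., φ(r) depends only on ‖r‖_p^p) with φ(0) = 1. Then φ is positive definite on ℝ^{(ℕ)} if and only if there exist a finite positive Borel (Radon) measure μ on [0, ∞) and a constant b ≥ 0 such that φ(r) = ∫_0^∞ e^{−t ‖r‖_p^p} dμ(t) + b·χ_{{0}}(r) for all r ∈ ℝ^{(ℕ)}, where χ_{{0}} is the indicator function of the zero sequence; moreover, when such a pair exists, μ is uniquely determined by φ. -/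
open ComplexOrder

/-- The `p`-th power ℓ^p length `‖r‖_p^p = ∑ n |r n|^p` of a finitely supported real
sequence. -/
noncomputable def lppFinsupp (p : ℝ) (r : ℕ →₀ ℝ) : ℝ :=
  ∑ n ∈ r.support, |r n| ^ p

/-- A real-valued function on an additive group is positive definite. -/
def IsPositiveDefiniteAdd {G : Type*} [AddGroup G] (φ : G → ℝ) : Prop :=
  ∀ (n : ℕ) (x : Fin n → G) (c : Fin n → ℂ),
    0 ≤ ∑ j, ∑ k, c j * (starRingEnd ℂ) (c k) * (φ (x k - x j) : ℂ)

open MeasureTheory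

namespace LppAux

open Filter Topology

def PSD {ι : Type*} [Fintype ι] (K : ι → ι → ℝ) : Prop :=
  (∀ i j, K i j = K j i) ∧ ∀ c : ι → ℝ, 0 ≤ ∑ i, ∑ j, c i * c j * K i j

section psd
variable {ι : Type*} [Fintype ι]

lemma psd_iff (K : ι → ι → ℝ) : PSD K ↔ (Matrix.of K).PosSemidef := by
  rw [Matrix.posSemidef_iff_dotProduct_mulVec]
  refine and_congr ?_ ?_
  · constructor
    · intro h; ext i j; simpa using h j i
    · intro h i j; have := congrFun (congrFun h j) i; simpa using this
  · refine forall_congr' fun c => ?_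
    have : ∑ i, ∑ j, c i * c j * K i j = star c ⬝ᵥ (Matrix.of K).mulVec c := by
      simp only [dotProduct, Matrix.mulVec, Finset.mul_sum]
      refine Finset.sum_congr rfl fun i _ => Finset.sum_congr rfl fun j _ => ?_
      simp; ring
    rw [this]

lemma PSD.mul {K L : ι → ι → ℝ} (hK : PSD K) (hL : PSD L) : PSD (fun i j => K i j * L i j) := by
  rw [psd_iff] at *
  exact hK.hadamard hL

lemma PSD.add {K L : ι → ι → ℝ} (hK : PSD K) (hL : PSD L) : PSD (fun i j => K i j + L i j) := by
  refine ⟨fun i j => by simp only [hK.1 i j, hL.1 i j], fun c => ?_⟩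
  simp only [mul_add, Finset.sum_add_distrib]
  exact add_nonneg (hK.2 c) (hL.2 c)

lemma PSD.smul {K : ι → ι → ℝ} (hK : PSD K) {a : ℝ} (ha : 0 ≤ a) : PSD (fun i j => a * K i j) := by
  refine ⟨fun i j => by simp only [hK.1 i j], fun c => ?_⟩
  have : ∑ i, ∑ j, c i * c j * (a * K i j) = a * ∑ i, ∑ j, c i * c j * K i j := by
    simp only [Finset.mul_sum]
    refine Finset.sum_congr rfl fun i _ => Finset.sum_congr rfl fun j _ => by ring
  rw [this]
  exact mul_nonneg ha (hK.2 c)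

lemma PSD.rank1 (v : ι → ℝ) : PSD (fun i j => v i * v j) := by
  refine ⟨fun i j => mul_comm _ _, fun c => ?_⟩
  have : ∑ i, ∑ j, c i * c j * (v i * v j) = (∑ i, c i * v i) * ∑ j, c j * v j := by
    rw [Finset.sum_mul_sum]
    refine Finset.sum_congr rfl fun i _ => Finset.sum_congr rfl fun j _ => by ring
  rw [this]
  exact mul_self_nonneg _

lemma PSD.one : PSD (fun _ _ : ι => (1 : ℝ)) := by
  simpa using PSD.rank1 (fun _ : ι => (1 : ℝ))

lemma PSD.pow {K : ι → ι → ℝ} (hK : PSD K) (n : ℕ) : PSD (fun i j => K i j ^ n) := by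
  induction n with
  | zero => simpa using PSD.one
  | succ n ih => simpa only [pow_succ] using ih.mul hK

lemma PSD.lim {α : Type*} {l : Filter α} [l.NeBot] {K : α → ι → ι → ℝ} {L : ι → ι → ℝ}
    (hK : ∀ᶠ a in l, PSD (K a)) (h : ∀ i j, Tendsto (fun a => K a i j) l (𝓝 (L i j))) : PSD L := by
  constructor
  · intro i j
    refine tendsto_nhds_unique (h i j) ((h j i).congr' ?_)
    filter_upwards [hK] with a ha using (ha.1 _ _)
  · intro c
    have : Tendsto (fun a => ∑ i, ∑ j, c i * c j * K a i j) l
        (𝓝 (∑ i, ∑ j, c i * c j * L i j)) :=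
      tendsto_finsetSum _ fun i _ => tendsto_finsetSum _ fun j _ => (h i j).const_mul _
    refine ge_of_tendsto this ?_
    filter_upwards [hK] with a ha using ha.2 c

lemma PSD.exp {K : ι → ι → ℝ} (hK : PSD K) : PSD (fun i j => Real.exp (K i j)) := by
  refine PSD.lim (l := atTop) (K := fun (n : ℕ) i j => (1 + K i j / n) ^ n) ?_ ?_
  · refine Eventually.of_forall fun n => PSD.pow (PSD.one.add ?_) n
    have := hK.smul (a := (n : ℝ)⁻¹) (by positivity)
    simpa only [div_eq_inv_mul] using this
  · intro i j
    exact Real.tendsto_one_add_div_pow_exp (K i j)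

lemma PSD.sum {α : Type*} (s : Finset α) {K : α → ι → ι → ℝ} (h : ∀ a ∈ s, PSD (K a)) :
    PSD (fun i j => ∑ a ∈ s, K a i j) := by
  classical
  induction s using Finset.induction_on with
  | empty => exact ⟨by simp, by simp⟩
  | insert a s ha ih =>
    simp only [Finset.sum_insert ha]
    exact (h _ (Finset.mem_insert_self _ _)).add (ih fun b hb => h _ (Finset.mem_insert_of_mem hb))

lemma PSD.integral {α : Type*} [MeasurableSpace α] {ν : Measure α} {K : α → ι → ι → ℝ}
    (h : ∀ a, PSD (K a)) (hi : ∀ i j, Integrable (fun a => K a i j) ν) :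
    PSD (fun i j => ∫ a, K a i j ∂ν) := by
  refine ⟨fun i j => by simp only [(h _).1 i j], fun c => ?_⟩
  have : ∑ i, ∑ j, c i * c j * ∫ a, K a i j ∂ν = ∫ a, ∑ i, ∑ j, c i * c j * K a i j ∂ν := by
    rw [integral_finsetSum]
    · refine Finset.sum_congr rfl fun i _ => ?_
      rw [integral_finsetSum]
      · simp only [integral_const_mul]
      · intro j _; exact (hi i j).const_mul _
    · intro i _
      exact integrable_finsetSum _ fun j _ => (hi i j).const_mul _
  rw [this]
  exact integral_nonneg fun a => (h a).2 c

/-- negative type kernel gives exp(-t psi) psd. -/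
lemma PSD.schoenberg {D : ι → ι → ℝ} {v : ι → ℝ} (h : PSD (fun i j => v i + v j - D i j)) {t : ℝ}
    (ht : 0 ≤ t) : PSD (fun i j => Real.exp (-t * D i j)) := by
  have := (PSD.rank1 (fun i => Real.exp (-t * v i))).mul (h.smul ht).exp
  convert this using 3 with i j
  rw [← Real.exp_add, ← Real.exp_add]
  ring_nf

end psd

lemma intble {p : ℝ} (hp0 : 0 < p) (hp2 : p < 2) (x : ℝ) :
    IntegrableOn (fun s : ℝ => (1 - Real.cos (x * s)) * s ^ (-1 - p)) (Set.Ioi 0) := by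
  have hm : Measurable (fun s : ℝ => (1 - Real.cos (x * s)) * s ^ (-1 - p)) := by fun_prop
  rw [← Set.Ioc_union_Ioi_eq_Ioi (zero_le_one' ℝ)]
  refine IntegrableOn.union ?_ ?_
  · have : IntegrableOn (fun s : ℝ => x ^ 2 / 2 * s ^ (1 - p)) (Set.Ioc 0 1) := by
      have := (intervalIntegral.intervalIntegrable_rpow' (a := 0) (b := 1)
        (r := 1 - p) (by linarith)).1
      exact this.const_mul _
    refine this.mono' hm.aestronglyMeasurable ?_
    refine (ae_restrict_iff' measurableSet_Ioc).2 (Eventually.of_forall fun s hs => ?_)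
    have hs0 : 0 < s := hs.1
    have h1 := Real.cos_le_one (x * s)
    have h2 := Real.one_sub_sq_div_two_le_cos (x := x * s)
    have h3 : s ^ (1 - p) = s ^ 2 * s ^ (-1 - p) := by
      rw [← Real.rpow_natCast, ← Real.rpow_add hs0]; norm_num; ring_nf
    rw [Real.norm_eq_abs, abs_of_nonneg (mul_nonneg (by linarith) (by positivity)), h3, ← mul_assoc]
    gcongr
    nlinarith
  · have : IntegrableOn (fun s : ℝ => 2 * s ^ (-1 - p)) (Set.Ioi 1) :=
      (integrableOn_Ioi_rpow_of_lt (by linarith) zero_lt_one).const_mul _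
    refine this.mono' hm.aestronglyMeasurable ?_
    refine (ae_restrict_iff' measurableSet_Ioi).2 (Eventually.of_forall fun s hs => ?_)
    have hs0 : 0 < s := lt_trans zero_lt_one hs
    have h1 := Real.cos_le_one (x * s)
    have h2 := Real.neg_one_le_cos (x * s)
    rw [Real.norm_eq_abs, abs_of_nonneg (mul_nonneg (by linarith) (by positivity))]
    gcongr
    linarith

noncomputable def Cst (p : ℝ) : ℝ := ∫ s in Set.Ioi (0 : ℝ), (1 - Real.cos (1 * s)) * s ^ (-1 - p)

lemma Cst_pos {p : ℝ} (hp0 : 0 < p) (hp2 : p < 2) : 0 < Cst p := by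
  unfold Cst
  rw [setIntegral_pos_iff_support_of_nonneg_ae]
  · have : Set.Ioo (0 : ℝ) 1 ⊆ (Function.support fun s : ℝ => (1 - Real.cos (1 * s)) * s ^ (-1 - p))
        ∩ Set.Ioi 0 := by
      intro s hs
      refine ⟨?_, hs.1⟩
      have hs0 : 0 < s := hs.1
      have h : Real.cos s < 1 := by
        rw [← Real.cos_zero]
        exact Real.cos_lt_cos_of_nonneg_of_le_pi le_rfl
          (by linarith [hs.2, Real.pi_gt_three]) hs0
      simp only [Function.mem_support, one_mul]
      exact (mul_pos (by linarith) (by positivity)).ne'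
    exact lt_of_lt_of_le (by simp) (measure_mono this)
  · refine (ae_restrict_iff' measurableSet_Ioi).2 (Eventually.of_forall fun s hs => ?_)
    have hs0 : 0 < s := hs
    exact mul_nonneg (by linarith [Real.cos_le_one (1 * s)]) (by positivity)
  · exact intble hp0 hp2 1

lemma scale {p : ℝ} (hp0 : 0 < p) (x : ℝ) :
    ∫ s in Set.Ioi (0 : ℝ), (1 - Real.cos (x * s)) * s ^ (-1 - p) = Cst p * |x| ^ p := by
  by_cases hx : x = 0
  · subst hx; simp [Real.zero_rpow hp0.ne']
  have hx' : 0 < |x| := abs_pos.2 hx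
  have h := integral_comp_mul_left_Ioi' (fun s : ℝ => (1 - Real.cos (1 * s)) * s ^ (-1 - p)) 0 hx'
  rw [mul_zero] at h
  unfold Cst
  rw [← h, smul_eq_mul, mul_comm, ← mul_assoc, ← integral_const_mul]
  refine setIntegral_congr_fun measurableSet_Ioi fun s hs => ?_
  have hs0 : 0 < s := hs
  have e1 : Real.cos (1 * (|x| * s)) = Real.cos (x * s) := by
    rw [one_mul, ← Real.cos_abs (x * s), abs_mul, abs_of_pos hs0]
  simp only [e1, Real.mul_rpow hx'.le hs0.le]
  have : |x| ^ p * |x| * |x| ^ (-1 - p) = 1 := by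
    nth_rw 2 [← Real.rpow_one |x|]
    rw [← Real.rpow_add hx', ← Real.rpow_add hx']; ring_nf; simp
  linear_combination (-(1 - Real.cos (x * s)) * s ^ (-1 - p)) * this

lemma psd_abs {ι : Type*} [Fintype ι] {p : ℝ} (hp0 : 0 < p) (hp2 : p ≤ 2) (x : ι → ℝ) :
    PSD (fun i j => |x i| ^ p + |x j| ^ p - |x i - x j| ^ p) := by
  rcases hp2.lt_or_eq with hp2 | rfl
  · have hC := Cst_pos hp0 hp2
    have key : PSD (fun i j => ∫ s in Set.Ioi (0 : ℝ), ((1 - Real.cos (x i * s)) * s ^ (-1 - p)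
        + (1 - Real.cos (x j * s)) * s ^ (-1 - p)
        - (1 - Real.cos ((x i - x j) * s)) * s ^ (-1 - p))) := by
      have key2 : PSD (fun i j => ∫ s in Set.Ioi (0 : ℝ),
        |s| ^ (-1 - p) * ((1 - Real.cos (x i * s)) * (1 - Real.cos (x j * s))
          + Real.sin (x i * s) * Real.sin (x j * s))) := by
        refine PSD.integral (K := fun s i j => |s| ^ (-1 - p) *
          ((1 - Real.cos (x i * s)) * (1 - Real.cos (x j * s))
          + Real.sin (x i * s) * Real.sin (x j * s))) ?_ ?_
        · intro s
          exact ((PSD.rank1 _).add (PSD.rank1 _)).smul (by positivity)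
        · intro i j
          have := ((intble hp0 hp2 (x i)).add (intble hp0 hp2 (x j))).sub
            (intble hp0 hp2 (x i - x j))
          refine IntegrableOn.congr_fun this ?_ measurableSet_Ioi
          intro s hs
          have hs0 : 0 < s := hs
          simp only [Pi.add_apply, Pi.sub_apply, abs_of_pos hs0, sub_mul, Real.cos_sub]
          ring
      convert key2 using 3 with i j
      refine setIntegral_congr_fun measurableSet_Ioi fun s hs => ?_
      have hs0 : 0 < s := hs
      simp only [abs_of_pos hs0, sub_mul (x i), Real.cos_sub]
      ring
    have := key.smul (inv_nonneg.2 hC.le)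
    convert this using 3 with i j
    have i1 := intble hp0 hp2 (x i)
    have i2 := intble hp0 hp2 (x j)
    have i3 := intble hp0 hp2 (x i - x j)
    have i12 : Integrable (fun s : ℝ => (1 - Real.cos (x i * s)) * s ^ (-1 - p)
        + (1 - Real.cos (x j * s)) * s ^ (-1 - p)) (volume.restrict (Set.Ioi 0)) := i1.add i2
    rw [integral_sub i12 i3, integral_add i1 i2, scale hp0, scale hp0, scale hp0]
    field_simp
  · have := (PSD.rank1 x).smul (zero_le_two (α := ℝ))
    convert this using 3 with i j
    norm_num
    ring

lemma lpp_of_subset {p : ℝ} (hp0 : 0 < p) (r : ℕ →₀ ℝ) {s : Finset ℕ} (h : r.support ⊆ s) :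
    lppFinsupp p r = ∑ n ∈ s, |r n| ^ p := by
  unfold lppFinsupp
  refine Finset.sum_subset h fun n _ hn => ?_
  rw [Finsupp.notMem_support_iff.1 hn]
  simp [Real.zero_rpow hp0.ne']

lemma lpp_nonneg (p : ℝ) (r : ℕ →₀ ℝ) : 0 ≤ lppFinsupp p r :=
  Finset.sum_nonneg fun _ _ => by positivity

lemma lpp_pos {p : ℝ} {r : ℕ →₀ ℝ} (h : r ≠ 0) : 0 < lppFinsupp p r := by
  refine Finset.sum_pos (fun n hn => ?_) (Finsupp.support_nonempty_iff.2 h)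
  have := abs_pos.2 (Finsupp.mem_support_iff.1 hn)
  positivity

lemma lpp_zero (p : ℝ) : lppFinsupp p 0 = 0 := by simp [lppFinsupp]

lemma lpp_single {p : ℝ} (hp0 : 0 < p) (n : ℕ) (a : ℝ) :
    lppFinsupp p (Finsupp.single n a) = |a| ^ p := by
  rw [lpp_of_subset hp0 _ (Finsupp.support_single_subset)]
  simp

lemma lpp_neg (p : ℝ) (r : ℕ →₀ ℝ) : lppFinsupp p (-r) = lppFinsupp p r := by
  simp [lppFinsupp]

lemma lpp_sub_comm (p : ℝ) (r s : ℕ →₀ ℝ) : lppFinsupp p (r - s) = lppFinsupp p (s - r) := by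
  rw [← lpp_neg, neg_sub]

lemma lpp_add_single {p : ℝ} (hp0 : 0 < p) (r : ℕ →₀ ℝ) {n : ℕ} (hn : r n = 0) (a : ℝ) :
    lppFinsupp p (r + Finsupp.single n a) = lppFinsupp p r + |a| ^ p := by
  classical
  have hn' : n ∉ r.support := by simpa using hn
  have h1 : (r + Finsupp.single n a).support ⊆ insert n r.support := by
    refine Finsupp.support_add.trans ?_
    intro m hm
    rcases Finset.mem_union.1 hm with h | h
    · exact Finset.mem_insert_of_mem h
    · have := Finsupp.support_single_subset h
      simp_all
  rw [lpp_of_subset hp0 _ h1, Finset.sum_insert hn', add_comm]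
  congr 1
  · refine Finset.sum_congr rfl fun m hm => ?_
    have : m ≠ n := fun h => hn' (h ▸ hm)
    simp [this.symm]
  · simp [hn]

lemma psd_lpp {ι : Type*} [Fintype ι] {p : ℝ} (hp0 : 0 < p) (hp2 : p ≤ 2) (x : ι → ℕ →₀ ℝ) {t : ℝ}
    (ht : 0 ≤ t) : PSD (fun i j => Real.exp (-t * lppFinsupp p (x i - x j))) := by
  classical
  refine PSD.schoenberg (v := fun i => lppFinsupp p (x i)) ?_ ht
  let S := Finset.univ.biUnion fun i => (x i).support
  have hS : ∀ i, (x i).support ⊆ S := fun i =>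
    Finset.subset_biUnion_of_mem (fun i => (x i).support) (Finset.mem_univ i)
  have hS2 : ∀ i j, (x i - x j).support ⊆ S := fun i j =>
    Finsupp.support_sub.trans (Finset.union_subset (hS i) (hS j))
  have := PSD.sum S (K := fun n i j => |x i n| ^ p + |x j n| ^ p - |x i n - x j n| ^ p)
    (fun n _ => psd_abs hp0 hp2 (fun i => x i n))
  convert this using 3 with i j
  rw [lpp_of_subset hp0 _ (hS i), lpp_of_subset hp0 _ (hS j), lpp_of_subset hp0 _ (hS2 i j)]
  simp only [Finset.sum_sub_distrib, Finset.sum_add_distrib, Finsupp.sub_apply]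

lemma posdef_of_psd {φ : (ℕ →₀ ℝ) → ℝ}
    (h : ∀ (n : ℕ) (x : Fin n → ℕ →₀ ℝ), PSD (fun i j => φ (x i - x j))) :
    IsPositiveDefiniteAdd φ := by
  intro n x c
  obtain ⟨hs, hq⟩ := h n x
  replace hs : ∀ i j, φ (x i - x j) = φ (x j - x i) := hs
  have h1 := hq (fun i => (c i).re)
  have h2 := hq (fun i => (c i).im)
  rw [Complex.le_def]
  constructor
  · simp only [Complex.re_sum, Complex.zero_re]
    refine (add_nonneg h1 h2).trans_eq ?_
    simp only [← Finset.sum_add_distrib]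
    refine Finset.sum_congr rfl fun j _ => Finset.sum_congr rfl fun k _ => ?_
    rw [hs j k]
    simp
    ring
  · simp only [Complex.im_sum, Complex.zero_im]
    have e : ∀ j k, (c j * (starRingEnd ℂ) (c k) * (φ (x k - x j) : ℂ)).im
        = ((c j).im * (c k).re) * φ (x k - x j) - (c j).re * (c k).im * φ (x k - x j) := by
      intro j k; simp; ring
    simp only [e, Finset.sum_sub_distrib]
    rw [eq_comm, sub_eq_zero, Finset.sum_comm]
    refine Finset.sum_congr rfl fun j _ => Finset.sum_congr rfl fun k _ => ?_
    rw [hs k j]; ring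

lemma backward {p : ℝ} (hp0 : 0 < p) (hp2 : p ≤ 2) {φ : (ℕ →₀ ℝ) → ℝ}
    (μ : Measure (Set.Ici (0 : ℝ))) (b : ℝ) [IsFiniteMeasure μ] (hb : 0 ≤ b)
    (h : ∀ r : ℕ →₀ ℝ, φ r = (∫ t : Set.Ici (0 : ℝ), Real.exp (-(t : ℝ) * lppFinsupp p r) ∂μ)
            + Set.indicator ({0} : Set (ℕ →₀ ℝ)) (fun _ => b) r) : IsPositiveDefiniteAdd φ := by
  refine posdef_of_psd fun n x => ?_
  simp only [h]
  refine PSD.add ?_ ?_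
  · refine PSD.integral (K := fun (t : Set.Ici (0 : ℝ)) i j =>
      Real.exp (-(t : ℝ) * lppFinsupp p (x i - x j))) (fun t => psd_lpp hp0 hp2 x t.2) ?_
    intro i j
    refine Integrable.of_bound (C := 1) (by fun_prop) (Eventually.of_forall fun t => ?_)
    rw [Real.norm_eq_abs, Real.abs_exp, Real.exp_le_one_iff]
    have := mul_nonneg t.2 (lpp_nonneg p (x i - x j))
    linarith
  · refine PSD.lim (l := atTop) (K := fun (t : ℝ) i j =>
      b * Real.exp (-t * lppFinsupp p (x i - x j))) ?_ ?_
    · filter_upwards [eventually_ge_atTop 0] with t ht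
      exact (psd_lpp hp0 hp2 x ht).smul hb
    · intro i j
      by_cases hij : x i - x j = 0
      · simp [hij, lpp_zero]
      · rw [Set.indicator_of_notMem (by simpa using hij)]
        have hpos := lpp_pos (p := p) hij
        have : Tendsto (fun t : ℝ => Real.exp (-(t * lppFinsupp p (x i - x j)))) atTop (𝓝 0) :=
          Real.tendsto_exp_neg_atTop_nhds_zero.comp (tendsto_id.atTop_mul_const hpos)
        simpa using this.const_mul b

end LppAux

namespace LppAux

open Filter Topology Polynomial

def RC (p : ℝ) (f : ℝ → ℝ) : Prop :=
  ∀ (n : ℕ) (x : Fin n → ℕ →₀ ℝ) (c : Fin n → ℝ),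
    0 ≤ ∑ j, ∑ k, c j * c k * f (lppFinsupp p (x j - x k))

lemma RC.fintype {p : ℝ} {f : ℝ → ℝ} (h : RC p f) {ι : Type*} [Fintype ι] (x : ι → ℕ →₀ ℝ)
    (c : ι → ℝ) : 0 ≤ ∑ j, ∑ k, c j * c k * f (lppFinsupp p (x j - x k)) := by
  let e := (Fintype.equivFin ι).symm
  have := h _ (fun i => x (e i)) (fun i => c (e i))
  rw [← Equiv.sum_comp e]
  refine this.trans_eq (Finset.sum_congr rfl fun i _ => ?_)
  rw [← Equiv.sum_comp e]

lemma RC.nonneg {p : ℝ} (hp0 : 0 < p) {f : ℝ → ℝ} (h : RC p f) {s : ℝ} (hs : 0 ≤ s) : 0 ≤ f s := by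
  by_contra hneg
  push Not at hneg
  obtain ⟨N, hN⟩ := exists_nat_gt (f 0 / (-f s))
  rw [div_lt_iff₀ (by linarith)] at hN
  set a := (s / 2) ^ (1 / p) with ha
  have ha0 : 0 ≤ a := by positivity
  have hap : a ^ p = s / 2 := by
    rw [ha, ← Real.rpow_mul (by positivity), one_div_mul_cancel hp0.ne', Real.rpow_one]
  have := h (N + 1) (fun i => Finsupp.single (i : ℕ) a) (fun _ => 1)
  have e : ∀ j k : Fin (N + 1), f (lppFinsupp p (Finsupp.single (j : ℕ) a - Finsupp.single (k : ℕ) a))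
      = f s + if j = k then f 0 - f s else 0 := by
    intro j k
    split_ifs with hjk
    · subst hjk; simp [lpp_zero]
    · have hjk' : (j : ℕ) ≠ k := fun h => hjk (Fin.ext h)
      rw [sub_eq_add_neg, ← Finsupp.single_neg, lpp_add_single hp0 _ (by simp [hjk']), lpp_single hp0,
        abs_neg, abs_of_nonneg ha0, hap]
      simp
  simp only [e] at this
  simp [Finset.sum_add_distrib] at this
  have h2 : 0 ≤ ((N : ℝ) + 1) * (N * f s + f 0) := by linarith
  have h3 := nonneg_of_mul_nonneg_right h2 (by positivity)
  linarith

def Dif (h : ℝ) (f : ℝ → ℝ) : ℝ → ℝ := fun s => f s - f (s + h)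

lemma RC.dif {p : ℝ} (hp0 : 0 < p) {f : ℝ → ℝ} (hf : RC p f) {h : ℝ} (hh : 0 ≤ h) :
    RC p (Dif h f) := by
  classical
  intro n x c
  let S := Finset.univ.biUnion fun i => (x i).support
  obtain ⟨N, hN⟩ := Infinite.exists_notMem_finset S
  have hN' : ∀ i, x i N = 0 := by
    intro i
    rw [← Finsupp.notMem_support_iff]
    exact fun h => hN (Finset.mem_biUnion.2 ⟨i, Finset.mem_univ i, h⟩)
  set a := h ^ (1 / p) with ha
  have ha0 : 0 ≤ a := by positivity
  have hap : a ^ p = h := by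
    rw [ha, ← Real.rpow_mul (by positivity), one_div_mul_cancel hp0.ne', Real.rpow_one]
  have := hf.fintype (Sum.elim x (fun i => x i + Finsupp.single N a)) (Sum.elim c (fun i => -c i))
  have e1 : ∀ j k, lppFinsupp p (x j + Finsupp.single N a - x k) = lppFinsupp p (x j - x k) + h := by
    intro j k
    rw [add_sub_right_comm, lpp_add_single hp0 _ (by simp [hN']), abs_of_nonneg ha0, hap]
  have e2 : ∀ j k, lppFinsupp p (x j - (x k + Finsupp.single N a)) = lppFinsupp p (x j - x k) + h := by
    intro j k
    rw [lpp_sub_comm, e1, lpp_sub_comm]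
  simp only [Fintype.sum_sum_type, Sum.elim_inl, Sum.elim_inr, e1, e2, add_sub_add_right_eq_sub,
    ← Finset.sum_add_distrib] at this
  have h2 : 0 ≤ 2 * ∑ j, ∑ k, c j * c k * Dif h f (lppFinsupp p (x j - x k)) := by
    refine this.trans_eq ?_
    simp only [Finset.mul_sum, Dif]
    refine Finset.sum_congr rfl fun j _ => Finset.sum_congr rfl fun k _ => by ring
  linarith

lemma RC.iter {p : ℝ} (hp0 : 0 < p) {h : ℝ} (hh : 0 ≤ h) (m : ℕ) :
    ∀ {f : ℝ → ℝ}, RC p f → RC p ((Dif h)^[m] f) := by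
  induction m with
  | zero => intro f hf; exact hf
  | succ m ih => intro f hf; exact ih (hf.dif hp0 hh)

noncomputable def Lf (h : ℝ) (f : ℝ → ℝ) : ℝ[X] →ₗ[ℝ] ℝ :=
  Polynomial.lsum fun k => (f (k * h)) • LinearMap.id

lemma Lf_X (h : ℝ) (f : ℝ → ℝ) (k : ℕ) : Lf h f (X ^ k) = f (k * h) := by
  rw [X_pow_eq_monomial]
  simp [Lf, Polynomial.lsum_apply]

lemma Lf_dif (h : ℝ) (f : ℝ → ℝ) (q : ℝ[X]) : Lf h (Dif h f) q = Lf h f (q * (1 - X)) := by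
  have : Lf h (Dif h f) = Lf h f ∘ₗ LinearMap.mulRight ℝ (1 - X) := by
    ext k
    simp only [LinearMap.comp_apply, LinearMap.mulRight_apply]
    rw [← X_pow_eq_monomial, mul_sub, mul_one, ← pow_succ, map_sub, Lf_X, Lf_X, Lf_X, Dif]
    push_cast
    ring_nf
  rw [this]
  rfl

lemma Lf_iter (h : ℝ) (k m : ℕ) : ∀ f : ℝ → ℝ,
    Lf h f (X ^ k * (1 - X) ^ m) = (Dif h)^[m] f (k * h) := by
  induction m with
  | zero => intro f; simp [Lf_X]
  | succ m ih =>
    intro f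
    rw [Function.iterate_succ_apply, ← ih, Lf_dif, pow_succ, mul_assoc]

lemma poly_id (j n : ℕ) (hj : j ≤ n) :
    (X ^ j : ℝ[X]) = ∑ k ∈ Finset.range (n + 1),
      ((k.choose j : ℝ) / (n.choose j : ℝ)) • ((n.choose k : ℝ) • (X ^ k * (1 - X) ^ (n - k))) := by
  obtain ⟨m, rfl⟩ := Nat.exists_eq_add_of_le hj
  rw [add_assoc, Finset.sum_range_add, Finset.sum_eq_zero, zero_add]
  · have h1 : (X ^ j : ℝ[X]) = X ^ j * (X + (1 - X)) ^ m := by simp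
    rw [h1, add_pow, Finset.mul_sum]
    refine Finset.sum_congr rfl fun i hi => ?_
    have hi' : i ≤ m := by simpa [Nat.lt_succ_iff] using hi
    have h2 : ((j + i).choose j : ℝ) / ((j + m).choose j : ℝ) * ((j + m).choose (j + i) : ℝ)
        = m.choose i := by
      have h3 := Nat.choose_mul (n := j + m) (k := j + i) (s := j) (by omega)
      simp only [Nat.add_sub_cancel_left] at h3
      have h4 : ((j + m).choose j : ℝ) ≠ 0 := by
        exact_mod_cast (Nat.choose_pos (by omega)).ne'
      have h5 : ((j + m).choose (j + i) : ℝ) * ((j + i).choose j : ℝ)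
        = ((j + m).choose j : ℝ) * (m.choose i : ℝ) := by exact_mod_cast h3
      field_simp
      linarith
    rw [smul_smul, h2, Nat.add_sub_add_left, smul_eq_C_mul, pow_add]
    simp only [map_natCast]
    ring
  · intro k hk
    rw [Nat.choose_eq_zero_of_lt (by simpa using hk)]
    simp

lemma ratio (n k : ℕ) (hn : 0 < n) (hk : k ≤ n) (j : ℕ) : j ≤ n →
    (0 ≤ (k.choose j : ℝ) / (n.choose j : ℝ) ∧ (k.choose j : ℝ) / (n.choose j : ℝ) ≤ 1 ∧
    |((k : ℝ) / n) ^ j - (k.choose j : ℝ) / (n.choose j : ℝ)| ≤ (j : ℝ) ^ 2 / n) := by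
  have hn' : (0 : ℝ) < n := by exact_mod_cast hn
  have hk' : (k : ℝ) ≤ n := by exact_mod_cast hk
  have hkn : (k : ℝ) / n ≤ 1 := (div_le_one hn').2 hk'
  induction j with
  | zero => intro; simp
  | succ j ih =>
    intro hj
    obtain ⟨h0, h1, h2⟩ := ih (by omega)
    set R := (k.choose j : ℝ) / (n.choose j : ℝ) with hR
    set ρ : ℝ := ((k - j : ℕ) : ℝ) / ((n - j : ℕ) : ℝ) with hρ
    have hnj : (0 : ℝ) < ((n - j : ℕ) : ℝ) := by exact_mod_cast (by omega : 0 < n - j)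
    have hstep : (k.choose (j + 1) : ℝ) / (n.choose (j + 1) : ℝ) = R * ρ := by
      have e1 : (k.choose (j + 1) : ℝ) * (j + 1) = k.choose j * ((k - j : ℕ) : ℝ) := by
        exact_mod_cast Nat.choose_succ_right_eq k j
      have e2 : (n.choose (j + 1) : ℝ) * (j + 1) = n.choose j * ((n - j : ℕ) : ℝ) := by
        exact_mod_cast Nat.choose_succ_right_eq n j
      have hj1 : ((j : ℝ) + 1) ≠ 0 := by positivity
      rw [← mul_div_mul_right _ _ hj1, e1, e2, hR, hρ, div_mul_div_comm]
    have hρ0 : 0 ≤ ρ := by positivity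
    have hρ1 : ρ ≤ 1 := by
      rw [hρ, div_le_one hnj]; exact_mod_cast (by omega : k - j ≤ n - j)
    have hd : |(k : ℝ) / n - ρ| ≤ j / n := by
      rcases le_total k j with hkj | hkj
      · rw [hρ, Nat.sub_eq_zero_of_le hkj]
        simp only [Nat.cast_zero, zero_div, sub_zero]
        rw [abs_of_nonneg (by positivity)]
        gcongr
      · have hjn : (j : ℝ) < n := by exact_mod_cast (by omega : j < n)
        have e : (k : ℝ) / n - ρ = j / n * ((n - k) / (n - j)) := by
          rw [hρ, Nat.cast_sub hkj, Nat.cast_sub (by omega : j ≤ n)]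
          have : (n : ℝ) - j ≠ 0 := by linarith
          field_simp
          ring
        have hkj' : (j : ℝ) ≤ k := by exact_mod_cast hkj
        have g0 : 0 ≤ ((n : ℝ) - k) / (n - j) := div_nonneg (by linarith) (by linarith)
        have g1 : ((n : ℝ) - k) / (n - j) ≤ 1 := (div_le_one (by linarith)).2 (by linarith)
        rw [e, abs_of_nonneg (by positivity)]
        exact mul_le_of_le_one_right (by positivity) g1
    rw [hstep]
    refine ⟨by positivity, mul_le_one₀ h1 hρ0 hρ1, ?_⟩
    have e : ((k : ℝ) / n) ^ (j + 1) - R * ρ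
        = (((k : ℝ) / n) ^ j - R) * (k / n) + R * (k / n - ρ) := by ring
    rw [e]
    calc _ ≤ |(((k : ℝ) / n) ^ j - R) * (k / n)| + |R * (k / n - ρ)| := abs_add_le _ _
      _ = |((k : ℝ) / n) ^ j - R| * (k / n) + R * |k / n - ρ| := by
        rw [abs_mul, abs_mul, abs_of_nonneg h0, abs_of_nonneg (by positivity : (0 : ℝ) ≤ k / n)]
      _ ≤ (j : ℝ) ^ 2 / n * 1 + 1 * (j / n) := by gcongr
      _ ≤ _ := by
        push_cast
        rw [mul_one, one_mul, ← add_div]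
        gcongr
        nlinarith [(Nat.cast_nonneg j : (0 : ℝ) ≤ j)]

/-- Finite-stage approximating measure. -/
lemma stage {f : ℝ → ℝ} (h1 : f 0 = 1) {h : ℝ}  (hh : 0 ≤ h)
    (hf : ∀ (m : ℕ) (s : ℝ), 0 ≤ s → 0 ≤ (Dif h)^[m] f s) (n : ℕ) (hn : 0 < n) (M : ℕ) :
    ∃ ν : ProbabilityMeasure unitInterval, ∀ (q : ℝ) (j : ℕ), j ≤ n → 0 ≤ q → (j : ℝ) = M * q →
      |(∫ u : unitInterval, (u : ℝ) ^ q ∂(ν : Measure unitInterval)) - f (j * h)| ≤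
        (j : ℝ) ^ 2 / n := by
  set w : ℕ → ℝ := fun k => Lf h f ((n.choose k : ℝ) • (X ^ k * (1 - X) ^ (n - k))) with hw
  have hw0 : ∀ k, 0 ≤ w k := by
    intro k
    simp only [hw, map_smul, Lf_iter]
    exact mul_nonneg (by positivity) (hf _ _ (by positivity))
  have hmom : ∀ j ≤ n, f (j * h) = ∑ k ∈ Finset.range (n + 1),
      (k.choose j : ℝ) / (n.choose j : ℝ) * w k := by
    intro j hj
    rw [← Lf_X h f j, poly_id j n hj, map_sum]
    refine Finset.sum_congr rfl fun k _ => ?_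
    rw [map_smul, smul_eq_mul]
  have hsum : ∑ k ∈ Finset.range (n + 1), w k = 1 := by
    have := hmom 0 (Nat.zero_le _)
    simpa [h1] using this.symm
  have hn' : (0 : ℝ) < n := by exact_mod_cast hn
  let u : ℕ → unitInterval := fun k => (Set.projIcc 0 1 zero_le_one ((k : ℝ) / n)) ^ M
  have hu : ∀ k ∈ Finset.range (n + 1), (u k : ℝ) = ((k : ℝ) / n) ^ M := by
    intro k hk
    have hk' : (k : ℝ) ≤ n := by exact_mod_cast (by simpa [Nat.lt_succ_iff] using hk : k ≤ n)
    have : (k : ℝ) / n ∈ Set.Icc (0 : ℝ) 1 := ⟨by positivity, (div_le_one hn').2 hk'⟩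
    simp [u, Set.projIcc_of_mem _ this]
  let ν : Measure unitInterval :=
    ∑ k ∈ Finset.range (n + 1), ENNReal.ofReal (w k) • Measure.dirac (u k)
  have hν : IsProbabilityMeasure ν := by
    constructor
    simp only [ν, Measure.coe_finsetSum, Finset.sum_apply, Measure.smul_apply, measure_univ,
      smul_eq_mul, mul_one]
    rw [← ENNReal.ofReal_sum_of_nonneg (fun k _ => hw0 k), hsum, ENNReal.ofReal_one]
  refine ⟨⟨ν, hν⟩, fun q j hj hq hjq => ?_⟩
  have hInteg : ∫ u : unitInterval, (u : ℝ) ^ q ∂ν = ∑ k ∈ Finset.range (n + 1),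
      ((k : ℝ) / n) ^ j * w k := by
    have hc : Continuous fun u : unitInterval => (u : ℝ) ^ q :=
      continuous_subtype_val.rpow_const fun _ => Or.inr hq
    rw [integral_finsetSum_measure]
    · refine Finset.sum_congr rfl fun k hk => ?_
      rw [integral_smul_measure, integral_dirac, hu k hk, ENNReal.toReal_ofReal (hw0 k), smul_eq_mul,
        mul_comm, ← Real.rpow_natCast, ← Real.rpow_mul (by positivity), ← hjq, Real.rpow_natCast]
    · intro k hk
      refine Integrable.smul_measure ?_ ENNReal.ofReal_ne_top
      exact hc.integrable_of_hasCompactSupport (HasCompactSupport.of_compactSpace _)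
  simp only [ProbabilityMeasure.coe_mk]
  rw [hInteg, hmom j hj, ← Finset.sum_sub_distrib]
  calc _ ≤ ∑ k ∈ Finset.range (n + 1), |((k : ℝ) / n) ^ j * w k
        - (k.choose j : ℝ) / (n.choose j : ℝ) * w k| := Finset.abs_sum_le_sum_abs _ _
    _ ≤ ∑ k ∈ Finset.range (n + 1), (j : ℝ) ^ 2 / n * w k := by
      refine Finset.sum_le_sum fun k hk => ?_
      rw [← sub_mul, abs_mul, abs_of_nonneg (hw0 k)]
      have := (ratio n k hn (by simpa [Nat.lt_succ_iff] using hk) j hj).2.2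
      exact mul_le_mul_of_nonneg_right this (hw0 k)
    _ = _ := by rw [← Finset.mul_sum, hsum, mul_one]

lemma dyadic {f : ℝ → ℝ} (h1 : f 0 = 1)
    (hf : ∀ (h : ℝ), 0 ≤ h → ∀ (m : ℕ) (s : ℝ), 0 ≤ s → 0 ≤ (Dif h)^[m] f s) :
    ∃ ν : ProbabilityMeasure unitInterval, ∀ a b : ℕ,
      ∫ u : unitInterval, (u : ℝ) ^ ((a : ℝ) / 2 ^ b) ∂(ν : Measure unitInterval)
        = f ((a : ℝ) / 2 ^ b) := by
  have := fun m : ℕ => stage h1 (h := 1 / 2 ^ m) (by positivity) (hf (1 / 2 ^ m) (by positivity))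
    (8 ^ m) (by positivity) (2 ^ m)
  choose ν hν using this
  let U : Ultrafilter ℕ := hyperfilter ℕ
  obtain ⟨ν₀, -, h0⟩ := isCompact_univ.ultrafilter_le_nhds (U.map ν) (by simp)
  have h0' : Tendsto ν U (𝓝 ν₀) := h0
  refine ⟨ν₀, fun a b => ?_⟩
  set q : ℝ := (a : ℝ) / 2 ^ b with hq
  have hq0 : 0 ≤ q := by positivity
  have hc : Continuous fun u : unitInterval => (u : ℝ) ^ q :=
      continuous_subtype_val.rpow_const fun _ => Or.inr hq0
  have hlim := (ProbabilityMeasure.tendsto_iff_forall_integral_tendsto.1 h0')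
    (BoundedContinuousFunction.mkOfCompact ⟨_, hc⟩)
  simp only [BoundedContinuousFunction.mkOfCompact_apply, ContinuousMap.coe_mk] at hlim
  refine tendsto_nhds_unique hlim ?_
  have hU : (U : Filter ℕ) ≤ atTop := by
    rw [← Nat.cofinite_eq_atTop]; exact hyperfilter_le_cofinite
  refine Tendsto.mono_left ?_ hU
  rw [tendsto_iff_norm_sub_tendsto_zero]
  have hz : Tendsto (fun m : ℕ => (a : ℝ) ^ 2 * (1 / 2) ^ m) atTop (𝓝 0) := by
    simpa using (tendsto_pow_atTop_nhds_zero_of_lt_one (r := (1 / 2 : ℝ)) (by norm_num)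
      (by norm_num)).const_mul ((a : ℝ) ^ 2)
  refine squeeze_zero' (Eventually.of_forall fun _ => norm_nonneg _) ?_ hz
  filter_upwards [eventually_ge_atTop (max a b)] with m hm
  have hma : a ≤ m := (le_max_left _ _).trans hm
  have hmb : b ≤ m := (le_max_right _ _).trans hm
  have hjle : a * 2 ^ (m - b) ≤ a * 2 ^ m := by gcongr <;> omega
  have hale : a ≤ 2 ^ m := hma.trans Nat.lt_two_pow_self.le
  have h8 : 2 ^ m * 2 ^ m * 2 ^ m = 8 ^ m := by rw [← mul_pow, ← mul_pow]; norm_num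
  have hj : a * 2 ^ (m - b) ≤ 8 ^ m := by
    calc _ ≤ a * 2 ^ m := hjle
      _ ≤ 2 ^ m * 2 ^ m := by gcongr
      _ ≤ 2 ^ m * 2 ^ m * 2 ^ m := Nat.le_mul_of_pos_right _ (by positivity)
      _ = _ := h8
  have hpow : (2 : ℝ) ^ m = 2 ^ (m - b) * 2 ^ b := by rw [← pow_add]; congr 1; omega
  have e1 : ((a * 2 ^ (m - b) : ℕ) : ℝ) = (2 ^ m : ℕ) * q := by
    push_cast
    rw [hq, hpow]
    field_simp
  have := hν m q _ hj hq0 e1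
  have e2 : ((a * 2 ^ (m - b) : ℕ) : ℝ) * (1 / 2 ^ m) = q := by
    rw [e1]; push_cast; field_simp
  rw [e2] at this
  rw [Real.norm_eq_abs]
  refine this.trans ?_
  have h3 : ((a * 2 ^ (m - b) : ℕ) : ℝ) ≤ a * 2 ^ m := by exact_mod_cast hjle
  have h8' : (8 : ℝ) ^ m = 2 ^ m * 2 ^ m * 2 ^ m := by exact_mod_cast h8.symm
  calc _ ≤ ((a : ℝ) * 2 ^ m) ^ 2 / ((8 ^ m : ℕ) : ℝ) := by gcongr
    _ = _ := by
      push_cast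
      rw [h8', div_pow, one_pow]
      field_simp

lemma rpow_intble (ν : Measure unitInterval) [IsFiniteMeasure ν] {s : ℝ} (hs : 0 ≤ s) :
    Integrable (fun u : unitInterval => (u : ℝ) ^ s) ν := by
  have hc : Continuous fun u : unitInterval => (u : ℝ) ^ s :=
      continuous_subtype_val.rpow_const fun _ => Or.inr hs
  exact hc.integrable_of_hasCompactSupport (HasCompactSupport.of_compactSpace _)

lemma allreal {f : ℝ → ℝ}
    (hf : ∀ s t, 0 ≤ s → s ≤ t → f t ≤ f s) (ν : Measure unitInterval) [IsFiniteMeasure ν]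
    (h : ∀ a b : ℕ, ∫ u : unitInterval, (u : ℝ) ^ ((a : ℝ) / 2 ^ b) ∂ν
        = f ((a : ℝ) / 2 ^ b)) {s : ℝ} (hs : 0 < s) :
    ∫ u : unitInterval, (u : ℝ) ^ s ∂ν = f s := by
  have hcont : ∀ x : ℕ → ℝ, (∀ n, 0 ≤ x n) → Tendsto x atTop (𝓝 s) →
      Tendsto (fun n => ∫ u : unitInterval, (u : ℝ) ^ (x n) ∂ν) atTop
        (𝓝 (∫ u : unitInterval, (u : ℝ) ^ s ∂ν)) := by
    intro x hx0 hx
    refine tendsto_integral_of_dominated_convergence (fun _ => 1) ?_ (integrable_const _) ?_ ?_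
    · intro n; exact (rpow_intble ν (hx0 n)).aestronglyMeasurable
    · intro n
      refine Eventually.of_forall fun u => ?_
      rw [Real.norm_eq_abs, abs_of_nonneg (Real.rpow_nonneg u.2.1 _)]
      exact Real.rpow_le_one u.2.1 u.2.2 (hx0 n)
    · refine Eventually.of_forall fun u => ?_
      exact (Real.continuousAt_const_rpow' hs.ne').tendsto.comp hx
  have hp : Tendsto (fun n : ℕ => (2 : ℝ) ^ n) atTop atTop :=
    tendsto_pow_atTop_atTop_of_one_lt (by norm_num)
  have t1 : Tendsto (fun n : ℕ => ((⌊s * 2 ^ n⌋₊ : ℕ) : ℝ) / 2 ^ n) atTop (𝓝 s) :=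
    (tendsto_nat_floor_mul_div_atTop hs.le).comp hp
  have t2 : Tendsto (fun n : ℕ => ((⌊s * 2 ^ n⌋₊ + 1 : ℕ) : ℝ) / 2 ^ n) atTop (𝓝 s) := by
    have := t1.add (tendsto_inv_atTop_zero.comp hp)
    rw [add_zero] at this
    refine this.congr fun n => ?_
    simp only [Function.comp]
    push_cast
    rw [add_div, one_div]
  apply le_antisymm
  · refine le_of_tendsto (hcont _ (fun n => by positivity) t2) (Eventually.of_forall fun n => ?_)
    simp only [h]
    refine hf _ _ hs.le ?_
    rw [le_div_iff₀ (by positivity)]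
    push_cast
    exact (Nat.lt_floor_add_one _).le
  · refine ge_of_tendsto (hcont _ (fun n => by positivity) t1) (Eventually.of_forall fun n => ?_)
    simp only [h]
    refine hf _ _ (by positivity) ?_
    rw [div_le_iff₀ (by positivity)]
    exact Nat.floor_le (by positivity)

lemma forward {p : ℝ} (hp0 : 0 < p) {f : ℝ → ℝ} (h1 : f 0 = 1) (hf : RC p f) :
    ∃ (μ : Measure (Set.Ici (0 : ℝ))) (b : ℝ), IsFiniteMeasure μ ∧ 0 ≤ b ∧
      (∀ s, 0 < s → f s = ∫ t : Set.Ici (0 : ℝ), Real.exp (-(t : ℝ) * s) ∂μ) ∧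
      f 0 = (∫ t : Set.Ici (0 : ℝ), Real.exp (-(t : ℝ) * 0) ∂μ) + b := by
  have hD : ∀ (h : ℝ), 0 ≤ h → ∀ (m : ℕ) (s : ℝ), 0 ≤ s → 0 ≤ (Dif h)^[m] f s :=
    fun h hh m s hs => (RC.iter hp0 hh m hf).nonneg hp0 hs
  have hanti : ∀ s t, 0 ≤ s → s ≤ t → f t ≤ f s := by
    intro s t hs hst
    have := hD (t - s) (by linarith) 1 s hs
    simp [Dif] at this
    exact this
  obtain ⟨⟨ν, hν⟩, hdy⟩ := dyadic h1 hD
  simp only [ProbabilityMeasure.coe_mk] at hdy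
  let T : unitInterval → Set.Ici (0 : ℝ) := fun u => ⟨max 0 (-Real.log u), Set.mem_Ici.2 (le_max_left _ _)⟩
  have hT : Measurable T := by
    refine Measurable.subtype_mk ?_
    exact measurable_const.max (Real.measurable_log.comp measurable_subtype_coe).neg
  have hS : MeasurableSet ({0}ᶜ : Set unitInterval) := (measurableSet_singleton _).compl
  have hmap : ∀ s : ℝ, ∫ t : Set.Ici (0 : ℝ), Real.exp (-(t : ℝ) * s) ∂((ν.restrict {0}ᶜ).map T)
      = ∫ u in ({0}ᶜ : Set unitInterval), (u : ℝ) ^ s ∂ν := by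
    intro s
    rw [integral_map hT.aemeasurable (by fun_prop)]
    refine setIntegral_congr_fun hS fun u hu => ?_
    have hu0 : (0 : ℝ) < u := lt_of_le_of_ne u.2.1 (fun h => hu (Subtype.ext h.symm))
    have : 0 ≤ -Real.log u := neg_nonneg.2 (Real.log_nonpos u.2.1 u.2.2)
    simp only [T, max_eq_right this]
    rw [Real.rpow_def_of_pos hu0, neg_neg]
  refine ⟨(ν.restrict {0}ᶜ).map T, ν.real {0}, inferInstance, measureReal_nonneg, ?_, ?_⟩
  · intro s hs
    rw [hmap, ← allreal hanti ν hdy hs, setIntegral_eq_integral_of_forall_compl_eq_zero]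
    intro u hu
    have : u = 0 := by simpa using hu
    subst this
    simp [hs.ne']
  · rw [hmap, h1]
    simp only [Real.rpow_zero]
    simp only [integral_const, smul_eq_mul, mul_one, measureReal_restrict_apply_univ]
    rw [probReal_compl_eq_one_sub (measurableSet_singleton _)]
    ring

lemma uniq (μ₁ μ₂ : Measure (Set.Ici (0 : ℝ))) [IsFiniteMeasure μ₁] [IsFiniteMeasure μ₂]
    (h : ∀ s : ℝ, 0 < s → ∫ t : Set.Ici (0 : ℝ), Real.exp (-(t : ℝ) * s) ∂μ₁
      = ∫ t : Set.Ici (0 : ℝ), Real.exp (-(t : ℝ) * s) ∂μ₂) : μ₁ = μ₂ := by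
  have hb : ∀ (s : ℝ), 0 ≤ s → ∀ t : Set.Ici (0 : ℝ), ‖Real.exp (-(t : ℝ) * s)‖ ≤ 1 := by
    intro s hs t
    rw [Real.norm_eq_abs, Real.abs_exp, Real.exp_le_one_iff]
    have := mul_nonneg t.2 hs
    linarith
  have hlim : ∀ (μ : Measure (Set.Ici (0 : ℝ))) [IsFiniteMeasure μ],
      Tendsto (fun n : ℕ => ∫ t : Set.Ici (0 : ℝ), Real.exp (-(t : ℝ) * (1 / ((n : ℝ) + 1))) ∂μ)
        atTop (𝓝 (∫ t : Set.Ici (0 : ℝ), Real.exp (-(t : ℝ) * 0) ∂μ)) := by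
    intro μ _
    refine tendsto_integral_of_dominated_convergence (fun _ => 1) ?_ (integrable_const _) ?_ ?_
    · intro n; fun_prop
    · intro n; exact Eventually.of_forall fun t => hb _ (by positivity) t
    · refine Eventually.of_forall fun t => ?_
      exact (Real.continuous_exp.tendsto _).comp
        ((tendsto_one_div_add_atTop_nhds_zero_nat (𝕜 := ℝ)).const_mul _)
  have h' : ∀ n : ℕ, ∫ t : Set.Ici (0 : ℝ), Real.exp (-(t : ℝ) * n) ∂μ₁
      = ∫ t : Set.Ici (0 : ℝ), Real.exp (-(t : ℝ) * n) ∂μ₂ := by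
    intro n
    rcases Nat.eq_zero_or_pos n with rfl | hn
    · rw [Nat.cast_zero]
      refine tendsto_nhds_unique (hlim μ₁) ((hlim μ₂).congr fun n => ?_)
      exact (h _ (by positivity)).symm
    · exact h _ (by exact_mod_cast hn)
  let g : BoundedContinuousFunction (Set.Ici (0 : ℝ)) ℝ :=
    BoundedContinuousFunction.ofNormedAddCommGroup (fun t => Real.exp (-(t : ℝ) * 1))
      (by fun_prop) 1 (hb 1 zero_le_one)
  let A : StarSubalgebra ℝ (BoundedContinuousFunction (Set.Ici (0 : ℝ)) ℝ) :=
    { Algebra.adjoin ℝ {g} with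
      star_mem' := by
        intro a ha
        have : star a = a := by ext t; simp
        rw [this]; exact ha }
  have hpoly : ∀ (q : ℝ[X]) (t : Set.Ici (0 : ℝ)),
      (Polynomial.aeval g q) t = ∑ k ∈ Finset.range (q.natDegree + 1),
        q.coeff k * Real.exp (-(t : ℝ) * k) := by
    intro q t
    rw [Polynomial.aeval_eq_sum_range]
    simp only [BoundedContinuousFunction.coe_sum, Finset.sum_apply,
      BoundedContinuousFunction.coe_smul, BoundedContinuousFunction.coe_pow, Pi.pow_apply,
      smul_eq_mul]
    refine Finset.sum_congr rfl fun k _ => ?_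
    congr 1
    change Real.exp (-(t : ℝ) * 1) ^ k = _
    rw [← Real.exp_nat_mul]
    ring_nf
  have : PolishSpace (Set.Ici (0 : ℝ)) := isClosed_Ici.polishSpace
  refine ext_of_forall_mem_subalgebra_integral_eq_of_polish (𝕜 := ℝ) (A := A) ?_ ?_
  · intro x y hxy
    refine ⟨g, ⟨BoundedContinuousFunction.toContinuousMapStarₐ ℝ g, ?_, rfl⟩, ?_⟩
    · exact ⟨g, Algebra.subset_adjoin (Set.mem_singleton g), rfl⟩
    · intro he
      have he' : Real.exp (-(x : ℝ) * 1) = Real.exp (-(y : ℝ) * 1) := he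
      have := Real.exp_injective he'
      exact hxy (Subtype.ext (by linarith))
  · intro a ha
    have ha' : a ∈ Algebra.adjoin ℝ {g} := ha
    rw [Algebra.adjoin_singleton_eq_range_aeval] at ha'
    obtain ⟨q, rfl⟩ := ha'
    have key : ∀ (μ : Measure (Set.Ici (0 : ℝ))) [IsFiniteMeasure μ],
        ∫ t, (Polynomial.aeval g q) t ∂μ = ∑ k ∈ Finset.range (q.natDegree + 1),
        q.coeff k * ∫ t : Set.Ici (0 : ℝ), Real.exp (-(t : ℝ) * k) ∂μ := by
      intro μ _
      simp only [hpoly]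
      rw [integral_finsetSum]
      · simp only [integral_const_mul]
      · intro k _
        refine Integrable.const_mul ?_ _
        exact Integrable.of_bound (C := 1) (by fun_prop)
          (Eventually.of_forall fun t => hb _ (by positivity) t)
    have k1 := key μ₁
    have k2 := key μ₂
    simp only [h'] at k1
    exact k1.trans k2.symm

end LppAux

/-- A radial (w.r.t. `‖·‖_p^p`, `0 < p ≤ 2`) function on `ℝ^{(ℕ)}` with `φ(0) = 1` is
positive definite iff `φ(r) = ∫_0^∞ e^{−t‖r‖_p^p} dμ(t) + b·χ_{{0}}(r)` for some finite
positive Borel measure `μ` on `[0,∞)` and some `b ≥ 0`; moreover `μ` is then uniquely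
determined by `φ`. -/
theorem posDef_iff_laplace_lppFinsupp
    (p : ℝ) (hp0 : 0 < p) (hp2 : p ≤ 2)
    (φ : (ℕ →₀ ℝ) → ℝ)
    (hrad : ∃ φdot : ℝ → ℝ, ∀ r : ℕ →₀ ℝ, φ r = φdot (lppFinsupp p r))
    (hone : φ 0 = 1) :
    (IsPositiveDefiniteAdd φ ↔
      ∃ (μ : Measure (Set.Ici (0 : ℝ))) (b : ℝ), IsFiniteMeasure μ ∧ 0 ≤ b ∧
        ∀ r : ℕ →₀ ℝ,
          φ r = (∫ t : Set.Ici (0 : ℝ), Real.exp (-(t : ℝ) * lppFinsupp p r) ∂μ)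
            + Set.indicator ({0} : Set (ℕ →₀ ℝ)) (fun _ => b) r) ∧
    ∀ (μ₁ μ₂ : Measure (Set.Ici (0 : ℝ))) (b₁ b₂ : ℝ),
      IsFiniteMeasure μ₁ → IsFiniteMeasure μ₂ → 0 ≤ b₁ → 0 ≤ b₂ →
      (∀ r : ℕ →₀ ℝ,
        φ r = (∫ t : Set.Ici (0 : ℝ), Real.exp (-(t : ℝ) * lppFinsupp p r) ∂μ₁)
          + Set.indicator ({0} : Set (ℕ →₀ ℝ)) (fun _ => b₁) r) →
      (∀ r : ℕ →₀ ℝ,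
        φ r = (∫ t : Set.Ici (0 : ℝ), Real.exp (-(t : ℝ) * lppFinsupp p r) ∂μ₂)
          + Set.indicator ({0} : Set (ℕ →₀ ℝ)) (fun _ => b₂) r) →
      μ₁ = μ₂ := by
  obtain ⟨f, hf⟩ := hrad
  have hf0 : f 0 = 1 := by rw [← hone, hf, LppAux.lpp_zero]
  refine ⟨⟨fun hpd => ?_, ?_⟩, ?_⟩
  · have hRC : LppAux.RC p f := by
      intro n x c
      have := hpd n x (fun i => (c i : ℂ))
      rw [Complex.le_def] at this
      have h2 := this.1
      simp only [Complex.re_sum, Complex.zero_re] at h2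
      refine h2.trans_eq ?_
      refine Finset.sum_congr rfl fun j _ => Finset.sum_congr rfl fun k _ => ?_
      rw [hf, LppAux.lpp_sub_comm]
      simp
    obtain ⟨μ, b, hμ, hb, h1, h2⟩ := LppAux.forward hp0 hf0 hRC
    refine ⟨μ, b, hμ, hb, fun r => ?_⟩
    by_cases hr : r = 0
    · subst hr
      rw [hf, LppAux.lpp_zero, h2]
      simp
    · rw [hf, h1 _ (LppAux.lpp_pos hr), Set.indicator_of_notMem (by simpa using hr), add_zero]
  · rintro ⟨μ, b, hμ, hb, h⟩
    exact LppAux.backward hp0 hp2 μ b hb h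
  · intro μ₁ μ₂ b₁ b₂ hμ₁ hμ₂ hb₁ hb₂ h₁ h₂
    refine LppAux.uniq μ₁ μ₂ fun s hs => ?_
    have hs' : 0 < s ^ (1 / p) := by positivity
    have hne : Finsupp.single 0 (s ^ (1 / p)) ≠ (0 : ℕ →₀ ℝ) := by
      rw [Finsupp.single_ne_zero]; exact hs'.ne'
    have hl : lppFinsupp p (Finsupp.single 0 (s ^ (1 / p))) = s := by
      rw [LppAux.lpp_single hp0, abs_of_pos hs', ← Real.rpow_mul hs.le]
      field_simp
      simp
    have e1 := h₁ (Finsupp.single 0 (s ^ (1 / p)))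
    have e2 := h₂ (Finsupp.single 0 (s ^ (1 / p)))
    rw [hl, Set.indicator_of_notMem (by simpa using hne), add_zero] at e1 e2
    rw [← e1, ← e2]
end

section
/- Fix 0 < p ≤ 2 and let ℝ^{(ℕ)} be the additive group of finitely supported real sequences. Let ψ : ℝ^{(ℕ)} → ℝ be a function radial with respect to ‖·‖_p^p with ψ(0) = 0. Then ψ is conditionally negative definite and bounded below on ℝ^{(ℕ)} if and only if there exist constants b, c ≥ 0 and a positive Borel measure ν on (0, ∞) with ∫_0^∞ (1 − e^{−t}) dν(t) < ∞ such that ψ(r) = c‖r‖_p^p + b·χ_{ℝ^{(ℕ)}∖{0}}(r) + ∫_0^∞ (1 − e^{−t ‖r‖_p^p}) dν(t) for all r ∈ ℝ^{(ℕ)}; moreover, when they exist, b, c, and ν are uniquely determined by ψ. -/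
open ComplexOrder

/-- A real-valued function on an additive group is conditionally negative definite. -/
def IsCondNegDefAdd {G : Type*} [AddGroup G] (ψ : G → ℝ) : Prop :=
  (∀ g : G, ψ (-g) = ψ g) ∧
    ∀ (n : ℕ) (x : Fin n → G) (c : Fin n → ℂ), (∑ j, c j) = 0 →
      ∑ j, ∑ k, c j * (starRingEnd ℂ) (c k) * (ψ (x k - x j) : ℂ) ≤ 0

open MeasureTheory


open MeasureTheory Filter Topology

/-- Moment uniqueness on the unit interval. -/
theorem lk_moment_unique (μ ν : Measure unitInterval) [IsFiniteMeasure μ] [IsFiniteMeasure ν]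
    (h : ∀ n : ℕ, ∫ x : unitInterval, (x : ℝ) ^ n ∂μ = ∫ x : unitInterval, (x : ℝ) ^ n ∂ν) :
    μ = ν := by
  have hint : ∀ (κ : Measure unitInterval) [IsFiniteMeasure κ] (f : unitInterval → ℝ),
      Continuous f → Integrable f κ := by
    intro κ _ f hf
    exact hf.integrable_of_hasCompactSupport (HasCompactSupport.of_compactSpace f)
  have hpoly : ∀ P : Polynomial ℝ, ∫ x : unitInterval, P.eval (x : ℝ) ∂μ
      = ∫ x : unitInterval, P.eval (x : ℝ) ∂ν := by
    intro P
    induction P using Polynomial.induction_on' with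
    | add p q hp hq =>
      simp only [Polynomial.eval_add]
      rw [integral_add (hint _ _ (by fun_prop)) (hint _ _ (by fun_prop)),
        integral_add (hint _ _ (by fun_prop)) (hint _ _ (by fun_prop)), hp, hq]
    | monomial n a =>
      simp only [Polynomial.eval_monomial]
      rw [integral_const_mul, integral_const_mul, h n]
  apply ext_of_forall_integral_eq_of_IsFiniteMeasure
  intro f
  refine eq_of_forall_dist_le fun ε hε => ?_
  set M : ℝ := μ.real Set.univ + ν.real Set.univ + 1 with hM
  have hMpos : 0 < M := by positivity
  obtain ⟨P, hP⟩ := exists_polynomial_near_continuousMap 0 1 f.toContinuousMap (ε / M)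
    (by positivity)
  have hP' : ∀ x : unitInterval, |P.eval (x : ℝ) - f x| ≤ ε / M := by
    intro x
    have := (ContinuousMap.norm_coe_le_norm (P.toContinuousMapOn (Set.Icc 0 1) - f.toContinuousMap) x)
    exact this.trans hP.le
  have key : ∀ (κ : Measure unitInterval) [IsFiniteMeasure κ],
      |∫ x, P.eval (x : ℝ) ∂κ - ∫ x, f x ∂κ| ≤ ε / M * κ.real Set.univ := by
    intro κ _
    rw [← integral_sub (hint _ _ (by fun_prop)) (hint _ _ (by fun_prop))]
    have := norm_integral_le_of_norm_le_const (μ := κ) (f := fun x : unitInterval => P.eval (x : ℝ) - f x) (Eventually.of_forall hP')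
    simpa using this
  have h1 := key μ
  have h2 := key ν
  rw [hpoly P] at h1
  rw [Real.dist_eq]
  have h3 : ε / M * μ.real Set.univ + ε / M * ν.real Set.univ ≤ ε := by
    rw [← mul_add, div_mul_eq_mul_div, div_le_iff₀ hMpos]
    nlinarith
  rw [abs_le] at *
  constructor <;> linarith [h1.1, h1.2, h2.1, h2.2]

/-- difference operator -/
def lkDiff (a : ℕ → ℝ) : ℕ → ℝ := fun n => a n - a (n + 1)

open Polynomial in
theorem lk_functional (a : ℕ → ℝ) : ∃ L : ℝ[X] →ₗ[ℝ] ℝ, (∀ n, L (X ^ n) = a n) ∧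
    ∀ m k, L (X ^ k * (1 - X) ^ m) = lkDiff^[m] a k := by
  let L : ℝ[X] →ₗ[ℝ] ℝ := Polynomial.lsum (fun n => (a n) • LinearMap.id)
  have hL : ∀ n, L (X ^ n) = a n := by
    intro n
    simp [L, Polynomial.lsum_apply, ← Polynomial.monomial_one_right_eq_X_pow,
      Polynomial.sum_monomial_index]
  refine ⟨L, hL, ?_⟩
  intro m
  induction m with
  | zero => intro k; simp [hL]
  | succ m ih =>
    intro k
    rw [Function.iterate_succ_apply', lkDiff, ← ih k, ← ih (k + 1), ← map_sub]
    congr 1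
    ring

open Polynomial in
theorem lk_sum_identity (a : ℕ → ℝ) (N j : ℕ) :
    a j = ∑ i ∈ Finset.range (N + 1), (N.choose i : ℝ) * lkDiff^[N - i] a (j + i) := by
  obtain ⟨L, hL, hL2⟩ := lk_functional a
  have := bernsteinPolynomial.sum ℝ N
  calc a j = L (X ^ j * ∑ i ∈ Finset.range (N + 1), bernsteinPolynomial ℝ N i) := by
        rw [this, mul_one, hL]
    _ = _ := by
        rw [Finset.mul_sum, map_sum]
        refine Finset.sum_congr rfl fun i _ => ?_
        rw [← hL2, ← smul_eq_mul (N.choose i : ℝ), ← map_smul]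
        congr 1
        rw [bernsteinPolynomial, Polynomial.smul_eq_C_mul, pow_add]
        simp
        ring

/-- The identity in factorial-moment form. -/
theorem lk_factorial_identity (a : ℕ → ℝ) (n j : ℕ) (hj : j ≤ n) :
    a j = ∑ k ∈ Finset.range (n + 1), ((n.choose k : ℝ) * lkDiff^[n - k] a k) *
      ((k.descFactorial j : ℝ) / (n.descFactorial j : ℝ)) := by
  rw [lk_sum_identity a (n - j) j]
  have hsplit : n + 1 = j + (n - j + 1) := by omega
  rw [hsplit, Finset.sum_range_add _ j (n - j + 1)]
  rw [Finset.sum_eq_zero (s := Finset.range j), zero_add]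
  · refine Finset.sum_congr rfl fun i hi => ?_
    have hi' : i ≤ n - j := by simpa [Nat.lt_succ_iff] using hi
    have e1 : n - j - i = n - (j + i) := by omega
    rw [e1, mul_right_comm]
    congr 1
    have hne : ((n.descFactorial j : ℕ) : ℝ) ≠ 0 := by
      exact_mod_cast (Nat.descFactorial_pos.2 hj).ne'
    rw [← mul_div_assoc, eq_div_iff hne]
    have := Nat.choose_mul (n := n) (k := j + i) (s := j) (by omega)
    rw [Nat.descFactorial_eq_factorial_mul_choose, Nat.descFactorial_eq_factorial_mul_choose]
    have h2 : (j + i) - j = i := by omega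
    rw [h2] at this
    have h3 : ((n.choose (j+i) : ℝ)) * ((j+i).choose j) = n.choose j * (n-j).choose i := by
      exact_mod_cast this
    push_cast
    linear_combination (-(j.factorial : ℝ)) * h3
  · intro k hk
    rw [Nat.descFactorial_of_lt (by simpa using hk)]
    simp

theorem lk_descFactorial_approx (j : ℕ) : ∃ ε : ℕ → ℝ, Tendsto ε atTop (𝓝 0) ∧
    ∀ᶠ n : ℕ in atTop, ∀ k ≤ n,
      |((k : ℝ) / n) ^ j - (k.descFactorial j : ℝ) / (n.descFactorial j : ℝ)| ≤ ε n := by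
  induction j with
  | zero => exact ⟨fun _ => 0, tendsto_const_nhds, by simp⟩
  | succ j ih =>
    obtain ⟨ε, hε, h⟩ := ih
    refine ⟨fun n => ε n + j / ((n : ℝ) - j), ?_, ?_⟩
    · have : Tendsto (fun n : ℕ => (j : ℝ) / ((n : ℝ) - j)) atTop (𝓝 0) := by
        apply Tendsto.const_div_atTop
        exact tendsto_atTop_add_const_right _ _ tendsto_natCast_atTop_atTop
      simpa using hε.add this
    · filter_upwards [h, eventually_gt_atTop j] with n hn hjn k hk
      have hjn' : (j : ℝ) < n := by exact_mod_cast hjn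
      have hn0 : (0 : ℝ) < n := lt_of_le_of_lt (by positivity) hjn'
      have hk' : (k : ℝ) ≤ n := by exact_mod_cast hk
      have hnj : ((n - j : ℕ) : ℝ) = (n : ℝ) - j := by
        rw [Nat.cast_sub hjn.le]
      rw [Nat.descFactorial_succ, Nat.descFactorial_succ, pow_succ']
      push_cast
      rw [hnj]
      set A := ((k : ℝ) / n) ^ j
      set B := (k.descFactorial j : ℝ) / (n.descFactorial j : ℝ) with hB
      set x := (k : ℝ) / n with hx
      set y := ((k - j : ℕ) : ℝ) / ((n : ℝ) - j) with hy
      rw [show ((k - j : ℕ) : ℝ) * (k.descFactorial j : ℝ) / (((n : ℝ) - j) * n.descFactorial j)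
        = y * B by rw [hy, hB, div_mul_div_comm]]
      have hx0 : 0 ≤ x := by positivity
      have hx1 : x ≤ 1 := div_le_one_of_le₀ hk' hn0.le
      have hB0 : 0 ≤ B := by positivity
      have hB1 : B ≤ 1 := by
        apply div_le_one_of_le₀ _ (by positivity)
        exact_mod_cast Nat.descFactorial_le j hk
      have hxy : |x - y| ≤ j / ((n : ℝ) - j) := by
        have hd : (0 : ℝ) < (n : ℝ) - j := by linarith
        have hkj1 : (k : ℝ) - j ≤ ((k - j : ℕ) : ℝ) := by
          have : k ≤ (k - j) + j := by omega
          have : (k : ℝ) ≤ ((k - j : ℕ) : ℝ) + j := by exact_mod_cast this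
          linarith
        have hkj2 : ((k - j : ℕ) : ℝ) ≤ k := by exact_mod_cast Nat.sub_le k j
        have hkx : (k : ℝ) = x * n := by rw [hx]; field_simp
        have hj0 : (0 : ℝ) ≤ j := by positivity
        have e : x - y = (x * ((n : ℝ) - j) - ((k - j : ℕ) : ℝ)) / ((n : ℝ) - j) := by
          rw [hy]; field_simp
        rw [e, abs_div, abs_of_pos hd]
        gcongr
        rw [abs_le]
        constructor
        · nlinarith
        · nlinarith
      have e : x * A - y * B = x * (A - B) + (x - y) * B := by ring
      rw [e]
      refine (abs_add_le _ _).trans ?_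
      rw [abs_mul, abs_mul, abs_of_nonneg hx0, abs_of_nonneg hB0]
      have h1 := hn k hk
      have h1' : |A - B| ≤ ε n := h1
      have := abs_nonneg (A - B)
      have := abs_nonneg (x - y)
      nlinarith

/-- Hausdorff moment theorem. -/
theorem lk_hausdorff (a : ℕ → ℝ) (ha : ∀ m k, 0 ≤ lkDiff^[m] a k) :
    ∃ μ : Measure unitInterval, IsFiniteMeasure μ ∧
      ∀ n : ℕ, ∫ x : unitInterval, (x : ℝ) ^ n ∂μ = a n := by
  have ha0 : 0 ≤ a 0 := ha 0 0
  let w : ℕ → ℕ → ℝ := fun n k => (n.choose k : ℝ) * lkDiff^[n - k] a k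
  have hw : ∀ n k, 0 ≤ w n k := fun n k => mul_nonneg (by positivity) (ha _ _)
  have hwsum : ∀ n, ∑ k ∈ Finset.range (n + 1), w n k = a 0 := by
    intro n
    rw [lk_sum_identity a n 0]
    simp [w]
  let pt : ℕ → ℕ → unitInterval := fun n k =>
    Set.projIcc 0 1 zero_le_one ((k : ℝ) / n)
  let m : ℕ → Measure unitInterval := fun n =>
    ∑ k ∈ Finset.range (n + 1), ENNReal.ofReal (w n k) • Measure.dirac (pt n k)
  have hmass : ∀ n, m n Set.univ = ENNReal.ofReal (a 0) := by
    intro n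
    rw [← hwsum n, ENNReal.ofReal_sum_of_nonneg (fun _ _ => hw _ _)]
    simp [m]
  have hfin : ∀ n, IsFiniteMeasure (m n) := fun n => ⟨by rw [hmass]; exact ENNReal.ofReal_lt_top⟩
  have hmint : ∀ n (f : unitInterval → ℝ), Continuous f →
      ∫ x, f x ∂(m n) = ∑ k ∈ Finset.range (n + 1), w n k * f (pt n k) := by
    intro n f hf
    simp only [m]
    rw [integral_finsetSum_measure]
    · refine Finset.sum_congr rfl fun k _ => ?_
      rw [integral_smul_measure, integral_dirac, ENNReal.toReal_ofReal (hw _ _), smul_eq_mul]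
    · intro k _
      apply Integrable.smul_measure _ ENNReal.ofReal_ne_top
      exact integrable_dirac (by simp [enorm_lt_top])
  let M : ℕ → FiniteMeasure unitInterval := fun n => ⟨m n, hfin n⟩
  have hcomp := isCompact_setOfPred_finiteMeasure_le_of_compactSpace (E := unitInterval)
    (Real.toNNReal (a 0))
  let U : Ultrafilter ℕ := hyperfilter ℕ
  have hU : (U : Filter ℕ) ≤ atTop := by
    rw [← Nat.cofinite_eq_atTop]; exact Filter.hyperfilter_le_cofinite
  obtain ⟨μ, -, hμ⟩ := hcomp.ultrafilter_le_nhds (U.map M) (by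
    rw [le_principal_iff]
    refine Filter.Eventually.of_forall (p := fun n => M n ∈ {μ : FiniteMeasure unitInterval | μ.mass ≤ Real.toNNReal (a 0)}) ?_
    intro n
    simp only [Set.mem_ofPred_eq]
    have : ((M n).mass : ENNReal) ≤ ((Real.toNNReal (a 0) : NNReal) : ENNReal) := by
      rw [FiniteMeasure.ennreal_mass]
      exact (hmass n).le
    exact_mod_cast this)
  have hμ' : Tendsto M U (𝓝 μ) := hμ
  rw [FiniteMeasure.tendsto_iff_forall_integral_tendsto] at hμ'
  refine ⟨μ, inferInstance, fun j => ?_⟩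
  let f : BoundedContinuousFunction unitInterval ℝ :=
    BoundedContinuousFunction.mkOfCompact ⟨fun x : unitInterval => (x : ℝ) ^ j, by fun_prop⟩
  have h1 := hμ' f
  have h2 : Tendsto (fun n => ∫ x, f x ∂(M n : Measure unitInterval)) atTop (𝓝 (a j)) := by
    obtain ⟨ε, hε, hb⟩ := lk_descFactorial_approx j
    rw [tendsto_iff_dist_tendsto_zero]
    refine squeeze_zero' (g := fun n => a 0 * ε n) (Eventually.of_forall fun _ => dist_nonneg) ?_
      (by simpa using hε.const_mul (a 0))
    filter_upwards [hb, eventually_ge_atTop j, eventually_gt_atTop 0] with n hn hjn hn0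
    have e1 : ∫ x, f x ∂(M n : Measure unitInterval)
        = ∑ k ∈ Finset.range (n + 1), w n k * ((k : ℝ) / n) ^ j := by
      rw [show ∫ x, f x ∂(M n : Measure unitInterval) = ∫ x, f x ∂(m n) from rfl,
        hmint n f f.continuous]
      refine Finset.sum_congr rfl fun k hk => ?_
      congr 1
      have hk' : k ≤ n := by simpa [Nat.lt_succ_iff] using hk
      have : ((pt n k : unitInterval) : ℝ) = (k : ℝ) / n := by
        simp only [pt]
        rw [Set.projIcc_of_mem zero_le_one (x := (k : ℝ) / n)]
        exact ⟨by positivity, div_le_one_of_le₀ (by exact_mod_cast hk') (by positivity)⟩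
      simp [f, this]
    rw [e1, Real.dist_eq, lk_factorial_identity a n j hjn, ← Finset.sum_sub_distrib]
    refine (Finset.abs_sum_le_sum_abs _ _).trans ?_
    rw [← hwsum n, Finset.sum_mul]
    refine Finset.sum_le_sum fun k hk => ?_
    have hk' : k ≤ n := by simpa [Nat.lt_succ_iff] using hk
    change |w n k * _ - w n k * _| ≤ _
    rw [← mul_sub, abs_mul, abs_of_nonneg (hw n k)]
    exact mul_le_mul_of_nonneg_left (hn k hk') (hw n k)
  exact tendsto_nhds_unique h1 (h2.mono_left hU)

open MeasureTheory Filter Topology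

theorem lk_lpp_eq_sum {p : ℝ} (hp0 : 0 < p) (r : ℕ →₀ ℝ) (S : Finset ℕ) (hS : r.support ⊆ S) :
    lppFinsupp p r = ∑ n ∈ S, |r n| ^ p := by
  unfold lppFinsupp
  refine Finset.sum_subset hS fun n _ hn => ?_
  rw [Finsupp.notMem_support_iff.1 hn, abs_zero, Real.zero_rpow hp0.ne']

theorem lk_lpp_nonneg (p : ℝ) (r : ℕ →₀ ℝ) : 0 ≤ lppFinsupp p r :=
  Finset.sum_nonneg fun _ _ => Real.rpow_nonneg (abs_nonneg _) _

theorem lk_lpp_zero (p : ℝ) : lppFinsupp p 0 = 0 := by simp [lppFinsupp]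

theorem lk_lpp_neg (p : ℝ) (r : ℕ →₀ ℝ) : lppFinsupp p (-r) = lppFinsupp p r := by
  simp [lppFinsupp]

theorem lk_lpp_pos {p : ℝ} (r : ℕ →₀ ℝ) (hr : r ≠ 0) : 0 < lppFinsupp p r := by
  apply Finset.sum_pos
  · intro n hn
    exact Real.rpow_pos_of_pos (abs_pos.2 (Finsupp.mem_support_iff.1 hn)) _
  · exact Finsupp.support_nonempty_iff.2 hr

theorem lk_lpp_add {p : ℝ} (hp0 : 0 < p) (r s : ℕ →₀ ℝ) (h : Disjoint r.support s.support) :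
    lppFinsupp p (r + s) = lppFinsupp p r + lppFinsupp p s := by
  rw [lk_lpp_eq_sum hp0 (r + s) (r.support ∪ s.support) Finsupp.support_add,
    Finset.sum_union h]
  unfold lppFinsupp
  congr 1
  · refine Finset.sum_congr rfl fun n hn => ?_
    have := Finset.disjoint_left.1 h hn
    rw [Finsupp.add_apply, Finsupp.notMem_support_iff.1 this, add_zero]
  · refine Finset.sum_congr rfl fun n hn => ?_
    have := Finset.disjoint_right.1 h hn
    rw [Finsupp.add_apply, Finsupp.notMem_support_iff.1 this, zero_add]

theorem lk_lpp_single {p : ℝ} (hp0 : 0 < p) (m : ℕ) (u : ℝ) (hu : 0 ≤ u) :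
    lppFinsupp p (Finsupp.single m (u ^ p⁻¹)) = u := by
  rw [lk_lpp_eq_sum hp0 _ {m} Finsupp.support_single_subset]
  simp only [Finset.sum_singleton, Finsupp.single_eq_same]
  rw [abs_of_nonneg (Real.rpow_nonneg hu _), Real.rpow_inv_rpow hu hp0.ne']

theorem lk_lpp_single_sub {p : ℝ} (hp0 : 0 < p) (m m' : ℕ) (h : m ≠ m') (u : ℝ) (hu : 0 ≤ u) :
    lppFinsupp p (Finsupp.single m ((u / 2) ^ p⁻¹) - Finsupp.single m' ((u / 2) ^ p⁻¹)) = u := by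
  have hd : Disjoint (Finsupp.single m ((u / 2) ^ p⁻¹)).support
      (-Finsupp.single m' ((u / 2) ^ p⁻¹)).support := by
    rw [Finsupp.support_neg]
    exact Finset.disjoint_of_subset_left Finsupp.support_single_subset
      (Finset.disjoint_of_subset_right Finsupp.support_single_subset (by simpa using h))
  rw [sub_eq_add_neg, lk_lpp_add hp0 _ _ hd, lk_lpp_neg, lk_lpp_single hp0 _ _ (by positivity),
    lk_lpp_single hp0 _ _ (by positivity)]
  ring

/-- quadratic form of a radial kernel -/
noncomputable def lkForm (p : ℝ) (F : ℝ → ℝ) {ι : Type} [Fintype ι] (x : ι → ℕ →₀ ℝ) (c : ι → ℝ) : ℝ :=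
  ∑ j, ∑ k, c j * c k * F (lppFinsupp p (x k - x j))

/-- radial positive definiteness -/
def lkPD (p : ℝ) (F : ℝ → ℝ) : Prop :=
  ∀ (ι : Type) [Fintype ι] (x : ι → ℕ →₀ ℝ) (c : ι → ℝ), 0 ≤ lkForm p F x c

/-- doubling trick -/
theorem lk_double {p : ℝ} (hp0 : 0 < p) (F : ℝ → ℝ) (u : ℝ) (hu : 0 ≤ u) {ι : Type} [Fintype ι]
    (x : ι → ℕ →₀ ℝ) (c : ι → ℝ) :
    ∃ (x' : ι × Bool → ℕ →₀ ℝ) (c' : ι × Bool → ℝ), ∑ j, c' j = 0 ∧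
      lkForm p F x' c' = 2 * lkForm p (fun s => F s - F (s + u)) x c := by
  classical
  let S : Finset ℕ := Finset.univ.biUnion fun i => (x i).support
  obtain ⟨m, hm⟩ := Infinite.exists_notMem_finset S
  obtain ⟨m', hm'⟩ := Infinite.exists_notMem_finset (insert m S)
  have hmm : m ≠ m' := by
    rintro rfl
    exact hm' (Finset.mem_insert_self _ _)
  have hm'S : m' ∉ S := fun h => hm' (Finset.mem_insert_of_mem h)
  let t : ℝ := (u / 2) ^ p⁻¹
  let d : Bool → ℕ →₀ ℝ := fun a => if a then Finsupp.single m t else Finsupp.single m' t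
  have hdsupp : ∀ a b, (d a - d b).support ⊆ {m, m'} := by
    intro a b n hn
    simp only [Finset.mem_insert, Finset.mem_singleton]
    by_contra hcon
    push Not at hcon
    apply (Finsupp.mem_support_iff.1 hn)
    cases a <;> cases b <;> simp [d, hcon.1, hcon.2]
  have hxsupp : ∀ j k, (x k - x j).support ⊆ S := by
    intro j k n hn
    simp only [S, Finset.mem_biUnion, Finset.mem_univ, true_and]
    by_contra hcon
    push Not at hcon
    apply (Finsupp.mem_support_iff.1 hn)
    have h1 := Finsupp.notMem_support_iff.1 (hcon j)
    have h2 := Finsupp.notMem_support_iff.1 (hcon k)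
    simp [h1, h2]
  have hdN : ∀ a b, lppFinsupp p (d a - d b) = if a = b then 0 else u := by
    intro a b
    cases a <;> cases b
    · simp [lk_lpp_zero]
    · simpa [d] using lk_lpp_single_sub hp0 m' m hmm.symm u hu
    · simpa [d] using lk_lpp_single_sub hp0 m m' hmm u hu
    · simp [lk_lpp_zero]
  have hN : ∀ j k a b, lppFinsupp p ((x k + d b) - (x j + d a))
      = lppFinsupp p (x k - x j) + if b = a then 0 else u := by
    intro j k a b
    rw [← hdN, ← lk_lpp_add hp0]
    · congr 1; abel
    · refine Finset.disjoint_of_subset_left (hxsupp j k)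
        (Finset.disjoint_of_subset_right (hdsupp b a) ?_)
      simp [hm, hm'S]
  refine ⟨fun q => x q.1 + d q.2, fun q => c q.1 * (if q.2 then 1 else -1), ?_, ?_⟩
  · rw [Fintype.sum_prod_type]
    simp
  · unfold lkForm
    simp only [Fintype.sum_prod_type, Fintype.sum_bool, hN]
    simp only [Finset.mul_sum, ← Finset.sum_add_distrib]
    refine Finset.sum_congr rfl fun j _ => Finset.sum_congr rfl fun k _ => ?_
    simp
    ring

theorem lk_PD_step {p : ℝ} (hp0 : 0 < p) (F : ℝ → ℝ) (hF : lkPD p F) (u : ℝ) (hu : 0 ≤ u) :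
    lkPD p (fun s => F s - F (s + u)) := by
  intro ι _ x c
  obtain ⟨x', c', -, h⟩ := lk_double hp0 F u hu x c
  have := hF _ x' c'
  linarith

theorem lk_PD_nonneg {p : ℝ} (hp0 : 0 < p) (F : ℝ → ℝ) (hF : lkPD p F) (u : ℝ) (hu : 0 ≤ u) :
    0 ≤ F u := by
  by_contra hneg
  push Not at hneg
  have key : ∀ n : ℕ, 0 ≤ (n : ℝ) * F 0 + (n : ℝ) * ((n : ℝ) - 1) * F u := by
    intro n
    have h := hF (Fin n) (fun i => Finsupp.single (i : ℕ) ((u / 2) ^ p⁻¹)) (fun _ => 1)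
    have e : ∀ j k : Fin n, lppFinsupp p (Finsupp.single (k : ℕ) ((u / 2) ^ p⁻¹)
        - Finsupp.single (j : ℕ) ((u / 2) ^ p⁻¹)) = if j = k then 0 else u := by
      intro j k
      split_ifs with hjk
      · subst hjk; simp [lk_lpp_zero]
      · exact lk_lpp_single_sub hp0 _ _ (fun h' => hjk (Fin.ext h'.symm)) u hu
    unfold lkForm at h
    simp only [e] at h
    have e2 : ∀ j k : Fin n, (1 : ℝ) * 1 * F (if j = k then 0 else u)
        = F u + if j = k then F 0 - F u else 0 := by
      intro j k; split_ifs <;> ring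
    simp only [e2, Finset.sum_add_distrib] at h
    simp at h
    linarith
  obtain ⟨n, hn⟩ := exists_nat_gt (F 0 / (-F u) + 1)
  have hn1 : F 0 < ((n : ℝ) - 1) * (-F u) := by
    rw [← div_lt_iff₀ (by linarith)]; linarith
  have h := key n
  rcases Nat.eq_zero_or_pos n with h0 | h0
  · have hF0 : 0 ≤ F 0 := by
      have := key 1
      simpa using this
    subst h0
    have : 0 ≤ F 0 / (-F u) := div_nonneg hF0 (by linarith)
    simp at hn
    linarith
  · have : (0 : ℝ) < n := by exact_mod_cast h0
    nlinarith

/-- real quadratic form from complex conditional negative definiteness -/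
theorem lk_CND_real {p : ℝ} {ψ : (ℕ →₀ ℝ) → ℝ} {g : ℝ → ℝ} (hg : ∀ r, ψ r = g (lppFinsupp p r))
    (h : IsCondNegDefAdd ψ) {ι : Type} [Fintype ι] (x : ι → ℕ →₀ ℝ) (c : ι → ℝ)
    (hc : ∑ j, c j = 0) : lkForm p g x c ≤ 0 := by
  let e := Fintype.equivFin ι
  have h1 := h.2 (Fintype.card ι) (fun i => x (e.symm i)) (fun i => (c (e.symm i) : ℂ)) (by
    rw [← Complex.ofReal_sum, Equiv.sum_comp e.symm c, hc]; simp)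
  unfold lkForm
  have h2 : ∑ j, ∑ k, ((c (e.symm j) : ℂ)) * (starRingEnd ℂ) (c (e.symm k) : ℂ) *
      ((ψ (x (e.symm k) - x (e.symm j)) : ℝ) : ℂ) =
      ((∑ j, ∑ k, c j * c k * g (lppFinsupp p (x k - x j)) : ℝ) : ℂ) := by
    rw [← Equiv.sum_comp e.symm]
    push_cast
    refine Finset.sum_congr rfl fun j _ => ?_
    rw [← Equiv.sum_comp e.symm]
    refine Finset.sum_congr rfl fun k _ => ?_
    rw [hg, Complex.conj_ofReal]
  rw [h2] at h1
  exact_mod_cast h1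

theorem lk_CND_step {p : ℝ} (hp0 : 0 < p) {ψ : (ℕ →₀ ℝ) → ℝ} {g : ℝ → ℝ}
    (hg : ∀ r, ψ r = g (lppFinsupp p r))
    (h : IsCondNegDefAdd ψ) (u : ℝ) (hu : 0 ≤ u) : lkPD p (fun s => g (s + u) - g s) := by
  intro ι _ x c
  obtain ⟨x', c', hc', he⟩ := lk_double hp0 g u hu x c
  have h1 := lk_CND_real hg h x' c' hc'
  have : lkForm p (fun s => g (s + u) - g s) x c = - lkForm p (fun s => g s - g (s + u)) x c := by
    unfold lkForm
    simp only [← Finset.sum_neg_distrib]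
    refine Finset.sum_congr rfl fun j _ => Finset.sum_congr rfl fun k _ => by ring
  linarith

theorem lk_mono {p : ℝ} (hp0 : 0 < p) {ψ : (ℕ →₀ ℝ) → ℝ} {g : ℝ → ℝ}
    (hg : ∀ r, ψ r = g (lppFinsupp p r)) (h : IsCondNegDefAdd ψ) (s t : ℝ) (hs : 0 ≤ s)
    (hst : s ≤ t) : g s ≤ g t := by
  have := lk_PD_nonneg hp0 _ (lk_CND_step hp0 hg h (t - s) (by linarith)) s hs
  simp only [add_sub_cancel] at this
  linarith

theorem lk_CM {p : ℝ} (hp0 : 0 < p) {ψ : (ℕ →₀ ℝ) → ℝ} {g : ℝ → ℝ}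
    (hg : ∀ r, ψ r = g (lppFinsupp p r)) (h : IsCondNegDefAdd ψ) (u : ℝ) (hu : 0 ≤ u) (m k : ℕ) :
    0 ≤ lkDiff^[m] (fun n : ℕ => g ((n + 1 : ℕ) * u) - g (n * u)) k := by
  have key : ∀ m : ℕ, ∀ F : ℝ → ℝ, lkPD p F → ∀ k : ℕ,
      0 ≤ lkDiff^[m] (fun n : ℕ => F (n * u)) k := by
    intro m
    induction m with
    | zero => intro F hF k; exact lk_PD_nonneg hp0 F hF _ (by positivity)
    | succ m ih =>
      intro F hF k
      rw [Function.iterate_succ_apply]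
      have := ih _ (lk_PD_step hp0 F hF u hu) k
      convert this using 2
      funext n
      simp only [lkDiff]
      push_cast
      ring_nf
  have := key m _ (lk_CND_step hp0 hg h u hu) k
  convert this using 2
  funext n
  push_cast
  ring_nf

/-- Lévy–Khintchine kernel -/
noncomputable def lkK (s y : ℝ) : ℝ := if y = 1 then s else (1 - y ^ s) / (1 - y)

theorem lkK_identity (x : ℝ) (hx0 : 0 ≤ x) (n M : ℕ) (hM : 0 < M) :
    lkK ((n : ℝ) / M) (x ^ M) * ∑ j ∈ Finset.range M, x ^ j = ∑ j ∈ Finset.range n, x ^ j := by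
  have hM' : (M : ℝ) ≠ 0 := by exact_mod_cast hM.ne'
  by_cases h1 : x = 1
  · subst h1
    simp [lkK, hM']
  · have h2 : x ^ M ≠ 1 := by
      rw [Ne, pow_eq_one_iff_of_nonneg hx0 hM.ne']
      exact h1
    have e : (x ^ M) ^ ((n : ℝ) / M) = x ^ n := by
      rw [← Real.rpow_natCast x M, ← Real.rpow_mul hx0, mul_div_cancel₀ _ hM', Real.rpow_natCast]
    rw [lkK, if_neg h2, e, geom_sum_eq h1, geom_sum_eq h1]
    have h3 : 1 - x ^ M ≠ 0 := sub_ne_zero.2 (Ne.symm h2)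
    have h4 : x - 1 ≠ 0 := sub_ne_zero.2 h1
    field_simp
    ring

theorem lkK_nonneg (s y : ℝ) (hs : 0 ≤ s) (hy0 : 0 ≤ y) (hy1 : y ≤ 1) : 0 ≤ lkK s y := by
  unfold lkK
  split_ifs
  · exact hs
  · exact div_nonneg (sub_nonneg.2 (Real.rpow_le_one hy0 hy1 hs)) (sub_nonneg.2 hy1)

theorem lk_one_sub_le (s y : ℝ) (N : ℕ) (hs : 0 ≤ s) (hsN : s ≤ N) (hy0 : 0 < y) (hy1 : y ≤ 1) :
    1 - y ^ s ≤ N * (1 - y) := by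
  have h1 : y ^ (N : ℝ) ≤ y ^ s := Real.rpow_le_rpow_of_exponent_ge hy0 hy1 hsN
  rw [Real.rpow_natCast] at h1
  have h2 := one_add_mul_le_pow (a := y - 1) (by linarith) N
  rw [add_sub_cancel] at h2
  linarith

theorem lkK_le (s y : ℝ) (N : ℕ) (hs : 0 ≤ s) (hsN : s ≤ N) (hy0 : 0 ≤ y) (hy1 : y ≤ 1) :
    lkK s y ≤ N := by
  unfold lkK
  split_ifs with h
  · exact hsN
  · rcases hy0.eq_or_lt with rfl | hy
    · rcases hs.eq_or_lt with rfl | hs'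
      · simp
      · rw [Real.zero_rpow hs'.ne']
        have : 0 < N := by
          rcases Nat.eq_zero_or_pos N with h0 | h0
          · subst h0; simp at hsN; linarith
          · exact h0
        have : (1 : ℝ) ≤ N := by exact_mod_cast this
        simpa using this
    · rw [div_le_iff₀ (sub_pos.2 (lt_of_le_of_ne hy1 h))]
      exact lk_one_sub_le s y N hs hsN hy hy1

theorem lkK_measurable (s : ℝ) : Measurable fun y : unitInterval => lkK s (y : ℝ) := by
  unfold lkK
  refine Measurable.ite ?_ measurable_const (by fun_prop)
  exact measurableSet_eq_fun (by fun_prop) measurable_const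

theorem lkK_continuousAt (s y : ℝ) (hs : 0 < s) (hy0 : 0 ≤ y) :
    ContinuousAt (fun s => lkK s y) s := by
  unfold lkK
  split_ifs
  · exact continuousAt_id
  · rcases hy0.eq_or_lt with rfl | hy
    · have : (fun s : ℝ => (1 - (0 : ℝ) ^ s) / (1 - 0)) =ᶠ[𝓝 s] fun _ => 1 := by
        filter_upwards [lt_mem_nhds hs] with t ht
        rw [Real.zero_rpow (ne_of_gt ht)]; simp
      exact continuousAt_const.congr this.symm
    · have := Real.continuousAt_const_rpow (a := y) (b := s) hy.ne'
      exact (continuousAt_const.sub this).div_const _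

theorem lkK_integrable (μ : Measure unitInterval) [IsFiniteMeasure μ] (s : ℝ) (hs : 0 ≤ s) :
    Integrable (fun y : unitInterval => lkK s (y : ℝ)) μ := by
  refine Integrable.of_bound (lkK_measurable s).aestronglyMeasurable (⌈s⌉₊ : ℝ)
    (Eventually.of_forall fun y => ?_)
  rw [Real.norm_of_nonneg (lkK_nonneg s y hs y.2.1 y.2.2)]
  exact lkK_le s y _ hs (Nat.le_ceil s) y.2.1 y.2.2

theorem lkG_continuousAt (μ : Measure unitInterval) [IsFiniteMeasure μ] (s : ℝ) (hs : 0 < s) :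
    ContinuousAt (fun s => ∫ y : unitInterval, lkK s (y : ℝ) ∂μ) s := by
  refine continuousAt_of_dominated (bound := fun _ => ((⌈s⌉₊ + 1 : ℕ) : ℝ)) ?_ ?_ ?_ ?_
  · exact Eventually.of_forall fun s => (lkK_measurable s).aestronglyMeasurable
  · filter_upwards [lt_mem_nhds hs, gt_mem_nhds (show s < s + 1 by linarith)] with t ht ht2
    refine Eventually.of_forall fun y => ?_
    rw [Real.norm_of_nonneg (lkK_nonneg t y ht.le y.2.1 y.2.2)]
    refine lkK_le t y _ ht.le ?_ y.2.1 y.2.2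
    push_cast
    have := Nat.le_ceil s
    linarith
  · exact integrable_const _
  · exact Eventually.of_forall fun y => lkK_continuousAt s y hs y.2.1

theorem lk_rep_rat (g : ℝ → ℝ) (hg0 : g 0 = 0)
    (hCM : ∀ u : ℝ, 0 ≤ u → ∀ m k : ℕ,
      0 ≤ lkDiff^[m] (fun n : ℕ => g ((n + 1 : ℕ) * u) - g (n * u)) k) :
    ∃ μ : Measure unitInterval, IsFiniteMeasure μ ∧ ∀ n M : ℕ, 0 < M →
      g ((n : ℝ) / M) = ∫ y : unitInterval, lkK ((n : ℝ) / M) (y : ℝ) ∂μ := by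
  have hint : ∀ (κ : Measure unitInterval) [IsFiniteMeasure κ] (f : unitInterval → ℝ),
      Continuous f → Integrable f κ := by
    intro κ _ f hf
    exact hf.integrable_of_hasCompactSupport (HasCompactSupport.of_compactSpace f)
  obtain ⟨μ, hμ, hμm⟩ := lk_hausdorff _ (hCM 1 zero_le_one)
  refine ⟨μ, hμ, fun n M hM => ?_⟩
  have hM' : (M : ℝ) ≠ 0 := by exact_mod_cast hM.ne'
  obtain ⟨κ, hκ, hκm⟩ := lk_hausdorff _ (hCM (1 / (M : ℝ)) (by positivity))
  let w : unitInterval → ℝ := fun x => ∑ j ∈ Finset.range M, (x : ℝ) ^ j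
  have hwc : Continuous w := by fun_prop
  have hw0 : ∀ x, 0 ≤ w x := fun x => Finset.sum_nonneg fun j _ => pow_nonneg x.2.1 _
  let ρ : Measure unitInterval :=
    (κ.withDensity fun x => ENNReal.ofReal (w x)).map (fun x => x ^ M)
  have hfin : IsFiniteMeasure (κ.withDensity fun x => ENNReal.ofReal (w x)) :=
    isFiniteMeasure_withDensity_ofReal (hint κ w hwc).2
  have hpm : Measurable (fun x : unitInterval => x ^ M) := by
    exact (continuous_pow M).measurable
  have hρfin : IsFiniteMeasure ρ := by infer_instance
  have hρint : ∀ f : unitInterval → ℝ, Measurable f →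
      ∫ y, f y ∂ρ = ∫ x, w x * f (x ^ M) ∂κ := by
    intro f hf
    simp only [ρ]
    rw [integral_map hpm.aemeasurable hf.aestronglyMeasurable,
      integral_withDensity_eq_integral_toReal_smul (by fun_prop) (by simp)]
    refine integral_congr_ae (Eventually.of_forall fun x => ?_)
    simp [ENNReal.toReal_ofReal (hw0 x)]
  have tele : ∀ k l : ℕ, ∑ j ∈ Finset.range l, ∫ x : unitInterval, (x : ℝ) ^ (k + j) ∂κ
      = g ((k + l : ℕ) * (1 / (M : ℝ))) - g (k * (1 / (M : ℝ))) := by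
    intro k l
    induction l with
    | zero => simp
    | succ l ih =>
      rw [Finset.sum_range_succ, ih, hκm]
      rw [show k + l + 1 = k + (l + 1) from rfl]
      ring
  have hρμ : ρ = μ := by
    apply lk_moment_unique
    intro i
    rw [hμm, hρint (fun y => (y : ℝ) ^ i) (by fun_prop)]
    have e : ∀ x : unitInterval, w x * ((x ^ M : unitInterval) : ℝ) ^ i
        = ∑ j ∈ Finset.range M, (x : ℝ) ^ (M * i + j) := by
      intro x
      simp only [w, Finset.sum_mul]
      refine Finset.sum_congr rfl fun j _ => ?_
      push_cast
      ring
    simp only [e]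
    rw [integral_finsetSum _ (fun j _ => hint _ _ (by fun_prop)), tele]
    congr 2
    · push_cast
      field_simp
    · push_cast
      field_simp
  rw [← hρμ, hρint _ (lkK_measurable _)]
  have e : ∀ x : unitInterval, w x * lkK ((n : ℝ) / M) ((x ^ M : unitInterval) : ℝ)
      = ∑ j ∈ Finset.range n, (x : ℝ) ^ (0 + j) := by
    intro x
    rw [mul_comm]
    push_cast
    rw [lkK_identity x x.2.1 n M hM]
    simp
  simp only [e]
  rw [integral_finsetSum _ (fun j _ => hint _ _ (by fun_prop)), tele]
  simp [hg0, div_eq_mul_inv]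

theorem lk_rep (g : ℝ → ℝ) (hg0 : g 0 = 0)
    (hmono : ∀ s t : ℝ, 0 ≤ s → s ≤ t → g s ≤ g t)
    (hCM : ∀ u : ℝ, 0 ≤ u → ∀ m k : ℕ,
      0 ≤ lkDiff^[m] (fun n : ℕ => g ((n + 1 : ℕ) * u) - g (n * u)) k) :
    ∃ μ : Measure unitInterval, IsFiniteMeasure μ ∧ ∀ s : ℝ, 0 ≤ s →
      g s = ∫ y : unitInterval, lkK s (y : ℝ) ∂μ := by
  obtain ⟨μ, hμ, h⟩ := lk_rep_rat g hg0 hCM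
  refine ⟨μ, hμ, fun s hs => ?_⟩
  have hq : ∀ q : ℚ, 0 ≤ q → g q = ∫ y : unitInterval, lkK q (y : ℝ) ∂μ := by
    intro q hq
    have e : (q : ℝ) = (q.num.toNat : ℝ) / (q.den : ℝ) := by
      have h1 : ((q.num.toNat : ℤ)) = q.num := Int.toNat_of_nonneg (Rat.num_nonneg.2 hq)
      have h2 : ((q.num.toNat : ℝ)) = (q.num : ℝ) := by exact_mod_cast h1
      rw [h2]
      exact Rat.cast_def q
    rw [e]
    exact h _ _ q.den_pos
  rcases hs.eq_or_lt with rfl | hs0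
  · have := hq 0 le_rfl
    simpa using this
  · have hc := lkG_continuousAt μ s hs0
    rw [Metric.continuousAt_iff] at hc
    refine eq_of_forall_dist_le fun ε hε => ?_
    obtain ⟨δ, hδ, hd⟩ := hc ε hε
    obtain ⟨q1, hq1, hq1'⟩ := exists_rat_btwn (show max 0 (s - δ) < s from max_lt hs0 (by linarith))
    obtain ⟨q2, hq2, hq2'⟩ := exists_rat_btwn (show s < s + δ by linarith)
    have hq10 : (0 : ℝ) < q1 := lt_of_le_of_lt (le_max_left _ _) hq1
    have hq11 : s - δ < q1 := lt_of_le_of_lt (le_max_right _ _) hq1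
    have d1 := hd (x := (q1 : ℝ)) (by rw [Real.dist_eq, abs_lt]; constructor <;> linarith)
    have d2 := hd (x := (q2 : ℝ)) (by rw [Real.dist_eq, abs_lt]; constructor <;> linarith)
    rw [← hq q1 (by exact_mod_cast hq10.le)] at d1
    rw [← hq q2 (by exact_mod_cast (hs0.trans hq2).le)] at d2
    have m1 := hmono q1 s hq10.le hq1'.le
    have m2 := hmono s q2 hs0.le hq2.le
    rw [Real.dist_eq, abs_lt] at d1 d2
    rw [Real.dist_eq, abs_le]
    constructor <;> linarith [d1.1, d1.2, d2.1, d2.2]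

/-- the parametrisation of the open unit interval by `exp (-t)` -/
noncomputable def lkE (t : Set.Ioi (0 : ℝ)) : unitInterval :=
  ⟨Real.exp (-(t : ℝ)), (Real.exp_pos _).le, Real.exp_le_one_iff.2 (neg_nonpos.2 (le_of_lt t.2))⟩

theorem lkE_coe (t : Set.Ioi (0 : ℝ)) : ((lkE t : unitInterval) : ℝ) = Real.exp (-(t : ℝ)) := rfl

theorem lkE_lt_one (t : Set.Ioi (0 : ℝ)) : Real.exp (-(t : ℝ)) < 1 :=
  Real.exp_lt_one_iff.2 (neg_lt_zero.2 t.2)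

theorem lkE_emb : MeasurableEmbedding lkE := by
  have : StandardBorelSpace (Set.Ioi (0 : ℝ)) := measurableSet_Ioi.standardBorel
  apply Measurable.measurableEmbedding
  · apply Continuous.measurable
    unfold lkE
    fun_prop
  · intro s t h
    have h1 : Real.exp (-(s : ℝ)) = Real.exp (-(t : ℝ)) := by
      rw [← lkE_coe, ← lkE_coe, h]
    have := Real.exp_injective h1
    exact Subtype.ext (by linarith)

theorem lkE_range : Set.range lkE = ({0, 1} : Set unitInterval)ᶜ := by
  ext y
  simp only [Set.mem_range, Set.mem_compl_iff, Set.mem_insert_iff, Set.mem_singleton_iff, not_or]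
  constructor
  · rintro ⟨t, rfl⟩
    constructor
    · intro h
      have : Real.exp (-(t : ℝ)) = 0 := congrArg Subtype.val h
      exact (Real.exp_pos _).ne' this
    · intro h
      have : Real.exp (-(t : ℝ)) = 1 := congrArg Subtype.val h
      exact (lkE_lt_one t).ne this
  · rintro ⟨h0, h1⟩
    have hy0 : (0 : ℝ) < y := lt_of_le_of_ne y.2.1 (fun h => h0 (Subtype.ext h.symm))
    have hy1 : (y : ℝ) < 1 := lt_of_le_of_ne y.2.2 (fun h => h1 (Subtype.ext h))
    refine ⟨⟨-Real.log y, ?_⟩, ?_⟩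
    · exact neg_pos.2 (Real.log_neg hy0 hy1)
    · apply Subtype.ext
      rw [lkE_coe]
      simp [Real.exp_log hy0]

theorem lk_integral_split (μ : Measure unitInterval) [IsFiniteMeasure μ] (f : unitInterval → ℝ)
    (hf : Integrable f μ) :
    ∫ y, f y ∂μ = μ.real {0} * f 0 + μ.real {1} * f 1 + ∫ t, f (lkE t) ∂(μ.comap lkE) := by
  have h1 : ∫ t, f (lkE t) ∂(μ.comap lkE) = ∫ y in ({0, 1} : Set unitInterval)ᶜ, f y ∂μ := by
    rw [← lkE_emb.integral_map, lkE_emb.map_comap, lkE_range]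
  have hms : MeasurableSet ({0, 1} : Set unitInterval) := by measurability
  rw [h1, ← integral_add_compl hms hf]
  congr 1
  rw [Set.insert_eq, setIntegral_union (by simp) (by measurability) hf.integrableOn hf.integrableOn,
    integral_singleton, integral_singleton, smul_eq_mul, smul_eq_mul]

theorem lk_exp_rpow (t s : ℝ) : Real.exp (-t * s) = (Real.exp (-t)) ^ s := by
  rw [← Real.exp_mul]

theorem lk_density_measurable :
    Measurable fun t : Set.Ioi (0 : ℝ) => ENNReal.ofReal (1 - Real.exp (-(t : ℝ))) := by
  fun_prop

theorem lk_density_ne_zero (t : Set.Ioi (0 : ℝ)) :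
    ENNReal.ofReal (1 - Real.exp (-(t : ℝ))) ≠ 0 := by
  have := lkE_lt_one t
  simp only [ne_eq, ENNReal.ofReal_eq_zero, not_le]
  linarith

theorem lk_exists_triple (μ : Measure unitInterval) [IsFiniteMeasure μ] :
    ∃ (b c : ℝ) (ν : Measure (Set.Ioi (0 : ℝ))), 0 ≤ b ∧ 0 ≤ c ∧
        (∫⁻ t : Set.Ioi (0 : ℝ), ENNReal.ofReal (1 - Real.exp (-(t : ℝ))) ∂ν) < ⊤ ∧
        ∀ s : ℝ, 0 ≤ s → ∫ y : unitInterval, lkK s (y : ℝ) ∂μ =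
          c * s + (if s = 0 then 0 else b)
            + ∫ t : Set.Ioi (0 : ℝ), (1 - Real.exp (-(t : ℝ) * s)) ∂ν := by
  let D : Set.Ioi (0 : ℝ) → ENNReal := fun t => ENNReal.ofReal (1 - Real.exp (-(t : ℝ)))
  have hD : Measurable D := lk_density_measurable
  refine ⟨μ.real {0}, μ.real {1}, (μ.comap lkE).withDensity (fun t => (D t)⁻¹), measureReal_nonneg,
    measureReal_nonneg, ?_, ?_⟩
  · have : ((μ.comap lkE).withDensity (fun t => (D t)⁻¹)).withDensity D = μ.comap lkE := by
      have h := withDensity_inv_same (μ := μ.comap lkE) (f := fun t => (D t)⁻¹) hD.inv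
        (Eventually.of_forall fun t => by simp [D])
        (Eventually.of_forall fun t => ENNReal.inv_ne_top.2 (lk_density_ne_zero t))
      simpa using h
    rw [← setLIntegral_univ, ← withDensity_apply _ MeasurableSet.univ, this]
    rw [lkE_emb.comap_apply]
    exact measure_lt_top _ _
  · intro s hs
    rw [lk_integral_split μ _ (lkK_integrable μ s hs)]
    congr 1
    · have : lkK s ((0 : unitInterval) : ℝ) = if s = 0 then 0 else 1 := by
        unfold lkK
        split_ifs with h1 h2 h2
        · simp at h1
        · simp at h1
        · simp [h2]
        · simp [Real.zero_rpow h2]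
      rw [this]
      split_ifs with h
      · simp [lkK, h]
      · simp [lkK]; ring
    · rw [integral_withDensity_eq_integral_toReal_smul (f := fun t => (D t)⁻¹) hD.inv
        (Eventually.of_forall fun t => by
          rw [ENNReal.inv_lt_top]; exact pos_iff_ne_zero.2 (lk_density_ne_zero t))]
      refine integral_congr_ae (Eventually.of_forall fun t => ?_)
      have h1 := lkE_lt_one t
      have hK : lkK s ((lkE t : unitInterval) : ℝ)
          = (1 - Real.exp (-(t : ℝ)) ^ s) / (1 - Real.exp (-(t : ℝ))) := by
        rw [lkE_coe]
        exact if_neg h1.ne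
      simp only [D]
      rw [hK, ENNReal.toReal_inv, ENNReal.toReal_ofReal (by linarith), smul_eq_mul, lk_exp_rpow,
        div_eq_inv_mul]

theorem lk_integrable (ν : Measure (Set.Ioi (0 : ℝ)))
    (hν : (∫⁻ t : Set.Ioi (0 : ℝ), ENNReal.ofReal (1 - Real.exp (-(t : ℝ))) ∂ν) < ⊤)
    (s : ℝ) (hs : 0 ≤ s) :
    Integrable (fun t : Set.Ioi (0 : ℝ) => 1 - Real.exp (-(t : ℝ) * s)) ν := by
  have h1 : Integrable (fun t : Set.Ioi (0 : ℝ) => 1 - Real.exp (-(t : ℝ))) ν := by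
    refine ⟨by fun_prop, ?_⟩
    rw [hasFiniteIntegral_iff_ofReal]
    · exact hν
    · exact Eventually.of_forall fun t => by
        have := lkE_lt_one t
        simp only [Pi.zero_apply]
        linarith
  refine (h1.const_mul (⌈s⌉₊ : ℝ)).mono' (by fun_prop) (Eventually.of_forall fun t => ?_)
  have h2 := lkE_lt_one t
  rw [lk_exp_rpow, Real.norm_of_nonneg]
  · exact lk_one_sub_le s _ _ hs (Nat.le_ceil s) (Real.exp_pos _) h2.le
  · exact sub_nonneg.2 (Real.rpow_le_one (Real.exp_pos _).le h2.le hs)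

/-- finite measure on the unit interval attached to a triple -/
noncomputable def lkMu (b c : ℝ) (ν : Measure (Set.Ioi (0 : ℝ))) : Measure unitInterval :=
  ENNReal.ofReal b • Measure.dirac 0 + ENNReal.ofReal c • Measure.dirac 1 +
    (ν.withDensity fun t => ENNReal.ofReal (1 - Real.exp (-(t : ℝ)))).map lkE

theorem lkMu_finite (b c : ℝ) (ν : Measure (Set.Ioi (0 : ℝ)))
    (hν : (∫⁻ t : Set.Ioi (0 : ℝ), ENNReal.ofReal (1 - Real.exp (-(t : ℝ))) ∂ν) < ⊤) :
    IsFiniteMeasure (lkMu b c ν) := by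
  constructor
  unfold lkMu
  simp only [Measure.add_apply, Measure.smul_apply, smul_eq_mul, measure_univ, mul_one]
  rw [Measure.map_apply lkE_emb.measurable MeasurableSet.univ, Set.preimage_univ,
    withDensity_apply _ MeasurableSet.univ, setLIntegral_univ]
  exact ENNReal.add_lt_top.2 ⟨ENNReal.add_lt_top.2 ⟨ENNReal.ofReal_lt_top, ENNReal.ofReal_lt_top⟩, hν⟩

theorem lkMu_moment (b c : ℝ) (hb : 0 ≤ b) (hc : 0 ≤ c) (ν : Measure (Set.Ioi (0 : ℝ)))
    (hν : (∫⁻ t : Set.Ioi (0 : ℝ), ENNReal.ofReal (1 - Real.exp (-(t : ℝ))) ∂ν) < ⊤) (n : ℕ) :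
    ∫ y : unitInterval, (y : ℝ) ^ n ∂(lkMu b c ν) =
      (c * ((n : ℝ) + 1) + b
            + ∫ t : Set.Ioi (0 : ℝ), (1 - Real.exp (-(t : ℝ) * ((n : ℝ) + 1))) ∂ν) -
      (c * (n : ℝ) + (if (n : ℝ) = 0 then 0 else b)
            + ∫ t : Set.Ioi (0 : ℝ), (1 - Real.exp (-(t : ℝ) * (n : ℝ))) ∂ν) := by
  have := lkMu_finite b c ν hν
  have hi : Integrable (fun y : unitInterval => (y : ℝ) ^ n) (lkMu b c ν) :=
    (show Continuous fun y : unitInterval => (y : ℝ) ^ n by fun_prop).integrable_of_hasCompactSupport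
      (HasCompactSupport.of_compactSpace _)
  unfold lkMu at hi ⊢
  rw [integral_add_measure hi.left_of_add_measure hi.right_of_add_measure,
    integral_add_measure hi.left_of_add_measure.left_of_add_measure
      hi.left_of_add_measure.right_of_add_measure,
    integral_smul_measure, integral_smul_measure, integral_dirac, integral_dirac,
    lkE_emb.integral_map,
    integral_withDensity_eq_integral_toReal_smul lk_density_measurable (by simp)]
  have e : ∀ t : Set.Ioi (0 : ℝ),
      (ENNReal.ofReal (1 - Real.exp (-(t : ℝ)))).toReal • ((lkE t : unitInterval) : ℝ) ^ n
      = (1 - Real.exp (-(t : ℝ) * ((n : ℝ) + 1))) - (1 - Real.exp (-(t : ℝ) * (n : ℝ))) := by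
    intro t
    have := lkE_lt_one t
    rw [ENNReal.toReal_ofReal (by linarith), lkE_coe, smul_eq_mul, mul_add, Real.exp_add, mul_one,
      ← Real.exp_nat_mul, mul_comm (n : ℝ)]
    ring
  simp only [e]
  rw [integral_sub (lk_integrable ν hν _ (by positivity)) (lk_integrable ν hν _ (by positivity)),
    ENNReal.toReal_ofReal hb, ENNReal.toReal_ofReal hc]
  by_cases hn : n = 0
  · subst hn
    simp
    ring
  · simp [hn]
    ring

theorem lkMu_inj (b₁ c₁ : ℝ) (ν₁ : Measure (Set.Ioi (0 : ℝ))) (b₂ c₂ : ℝ)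
    (ν₂ : Measure (Set.Ioi (0 : ℝ))) (hb₁ : 0 ≤ b₁) (hc₁ : 0 ≤ c₁) (hb₂ : 0 ≤ b₂) (hc₂ : 0 ≤ c₂)
    (h : lkMu b₁ c₁ ν₁ = lkMu b₂ c₂ ν₂) : b₁ = b₂ ∧ c₁ = c₂ ∧ ν₁ = ν₂ := by
  have hr0 : lkE ⁻¹' {0} = ∅ := by
    rw [Set.preimage_singleton_eq_empty, lkE_range]; simp
  have hr1 : lkE ⁻¹' {1} = ∅ := by
    rw [Set.preimage_singleton_eq_empty, lkE_range]; simp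
  have h0 : ∀ b c ν, lkMu b c ν {0} = ENNReal.ofReal b := by
    intro b c ν
    unfold lkMu
    simp only [Measure.add_apply, Measure.smul_apply, smul_eq_mul]
    rw [lkE_emb.map_apply, hr0]
    simp
  have h1 : ∀ b c ν, lkMu b c ν {1} = ENNReal.ofReal c := by
    intro b c ν
    unfold lkMu
    simp only [Measure.add_apply, Measure.smul_apply, smul_eq_mul]
    rw [lkE_emb.map_apply, hr1]
    simp
  have h2 : ∀ b c ν, (lkMu b c ν).comap lkE
      = ν.withDensity fun t => ENNReal.ofReal (1 - Real.exp (-(t : ℝ))) := by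
    intro b c ν
    ext A hA
    rw [lkE_emb.comap_apply]
    unfold lkMu
    simp only [Measure.add_apply, Measure.smul_apply, smul_eq_mul]
    rw [lkE_emb.map_apply, Set.preimage_image_eq _ lkE_emb.injective]
    have hm := lkE_emb.measurableSet_image.2 hA
    have hsub : lkE '' A ⊆ ({0, 1} : Set unitInterval)ᶜ := by
      rw [← lkE_range]; exact Set.image_subset_range _ _
    have n0 : (0 : unitInterval) ∉ lkE '' A := fun hh => hsub hh (by simp)
    have n1 : (1 : unitInterval) ∉ lkE '' A := fun hh => hsub hh (by simp)
    rw [Measure.dirac_apply' _ hm, Measure.dirac_apply' _ hm]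
    simp [Set.indicator_of_notMem n0, Set.indicator_of_notMem n1]
  refine ⟨?_, ?_, ?_⟩
  · have := h0 b₁ c₁ ν₁
    rw [h, h0] at this
    exact ((ENNReal.ofReal_eq_ofReal_iff hb₂ hb₁).1 this).symm
  · have := h1 b₁ c₁ ν₁
    rw [h, h1] at this
    exact ((ENNReal.ofReal_eq_ofReal_iff hc₂ hc₁).1 this).symm
  · have h3 : ∀ ν : Measure (Set.Ioi (0 : ℝ)),
        (ν.withDensity fun t => ENNReal.ofReal (1 - Real.exp (-(t : ℝ)))).withDensity
          (fun t => (ENNReal.ofReal (1 - Real.exp (-(t : ℝ))))⁻¹) = ν := by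
      intro ν
      exact withDensity_inv_same lk_density_measurable
        (Eventually.of_forall lk_density_ne_zero) (by simp)
    rw [← h3 ν₁, ← h3 ν₂, ← h2 b₁ c₁ ν₁, ← h2 b₂ c₂ ν₂, h]

theorem lk_CND_of_real {G : Type*} [AddGroup G] (ψ : G → ℝ) (hs : ∀ g, ψ (-g) = ψ g)
    (h : ∀ (n : ℕ) (x : Fin n → G) (c : Fin n → ℝ), ∑ j, c j = 0 →
      ∑ j, ∑ k, c j * c k * ψ (x k - x j) ≤ 0) : IsCondNegDefAdd ψ := by
  refine ⟨hs, fun n x c hc => ?_⟩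
  have hre : ∑ j, (c j).re = 0 := by rw [← Complex.re_sum, hc]; rfl
  have him : ∑ j, (c j).im = 0 := by rw [← Complex.im_sum, hc]; rfl
  have h1 := h n x _ hre
  have h2 := h n x _ him
  rw [Complex.le_def]
  constructor
  · simp only [Complex.re_sum, Complex.mul_re, Complex.conj_re, Complex.conj_im, Complex.ofReal_re,
      Complex.ofReal_im, mul_zero, sub_zero, Complex.zero_re]
    have e : ∀ j k, ((c j).re * (c k).re - (c j).im * -(c k).im) * ψ (x k - x j)
        = (c j).re * (c k).re * ψ (x k - x j) + (c j).im * (c k).im * ψ (x k - x j) := by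
      intro j k; ring
    simp only [e, Finset.sum_add_distrib]
    linarith
  · simp only [Complex.im_sum, Complex.mul_im, Complex.mul_re, Complex.conj_re, Complex.conj_im,
      Complex.ofReal_re, Complex.ofReal_im, mul_zero, zero_add, Complex.zero_im]
    have e : ∀ j k, ((c j).re * -(c k).im + (c j).im * (c k).re) * ψ (x k - x j)
        = (c j).im * (c k).re * ψ (x k - x j) - (c j).re * (c k).im * ψ (x k - x j) := by
      intro j k; ring
    simp only [e, Finset.sum_sub_distrib]
    rw [sub_eq_zero, Finset.sum_comm]
    refine Finset.sum_congr rfl fun j _ => Finset.sum_congr rfl fun k _ => ?_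
    rw [← hs (x k - x j), neg_sub]
    ring

theorem lk_cos_integrable (p : ℝ) (hp0 : 0 < p) (hp2 : p < 2) (s : ℝ) :
    IntegrableOn (fun t : ℝ => (1 - Real.cos (s * t)) * t ^ (-1 - p)) (Set.Ioi 0) := by
  rw [← Set.Ioc_union_Ioi_eq_Ioi zero_le_one]
  have hmeas : Measurable (fun t : ℝ => (1 - Real.cos (s * t)) * t ^ (-1 - p)) := by fun_prop
  apply IntegrableOn.union
  · have h1 : IntegrableOn (fun t : ℝ => t ^ (1 - p)) (Set.Ioc 0 1) := by
      rw [integrableOn_Ioc_iff_integrableOn_Ioo,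
        intervalIntegral.integrableOn_Ioo_rpow_iff zero_lt_one]
      linarith
    refine Integrable.mono' (h1.const_mul (s ^ 2 / 2)) hmeas.aestronglyMeasurable ?_
    refine (ae_restrict_mem measurableSet_Ioc).mono fun t ht => ?_
    have ht0 : 0 < t := ht.1
    have hc := Real.cos_le_one (s * t)
    have hc2 := Real.one_sub_sq_div_two_le_cos (x := s * t)
    rw [Real.norm_of_nonneg (mul_nonneg (by linarith) (Real.rpow_nonneg ht0.le _))]
    have e : t ^ (1 - p) = t ^ 2 * t ^ (-1 - p) := by
      rw [← Real.rpow_natCast t 2, ← Real.rpow_add ht0]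
      congr 1
      push_cast
      ring
    rw [e, ← mul_assoc]
    refine mul_le_mul_of_nonneg_right ?_ (Real.rpow_nonneg ht0.le _)
    nlinarith
  · have h1 : IntegrableOn (fun t : ℝ => t ^ (-1 - p)) (Set.Ioi 1) :=
      integrableOn_Ioi_rpow_of_lt (by linarith) zero_lt_one
    refine Integrable.mono' (h1.const_mul 2) hmeas.aestronglyMeasurable ?_
    refine (ae_restrict_mem measurableSet_Ioi).mono fun t ht => ?_
    have ht0 : 0 < t := lt_trans zero_lt_one ht
    have hc := Real.cos_le_one (s * t)
    have hc2 := Real.neg_one_le_cos (s * t)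
    rw [Real.norm_of_nonneg (mul_nonneg (by linarith) (Real.rpow_nonneg ht0.le _))]
    exact mul_le_mul_of_nonneg_right (by linarith) (Real.rpow_nonneg ht0.le _)

theorem lk_cos_const (p : ℝ) (hp0 : 0 < p) (hp2 : p < 2) : ∃ C : ℝ, 0 < C ∧ ∀ s : ℝ,
    ∫ t in Set.Ioi (0 : ℝ), (1 - Real.cos (s * t)) * t ^ (-1 - p) = C * |s| ^ p := by
  refine ⟨∫ t in Set.Ioi (0 : ℝ), (1 - Real.cos (1 * t)) * t ^ (-1 - p), ?_, ?_⟩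
  · rw [setIntegral_pos_iff_support_of_nonneg_ae _ (lk_cos_integrable p hp0 hp2 1)]
    · refine lt_of_lt_of_le ?_ (measure_mono (s := Set.Ioo (0 : ℝ) 1) ?_)
      · simp
      · intro t ht
        refine ⟨?_, ht.1⟩
        simp only [Function.mem_support, one_mul]
        have h1 : Real.cos t < 1 := by
          have := Real.cos_lt_cos_of_nonneg_of_le_pi (x := 0) (y := t) le_rfl
            (by linarith [Real.pi_gt_three, ht.2]) ht.1
          simpa using this
        have := Real.rpow_pos_of_pos ht.1 (-1 - p)
        have : 0 < 1 - Real.cos t := by linarith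
        positivity
    · refine (ae_restrict_mem measurableSet_Ioi).mono fun t ht => ?_
      have hc := Real.cos_le_one (1 * t)
      exact mul_nonneg (by linarith) (Real.rpow_nonneg (le_of_lt ht) _)
  · intro s
    rcases eq_or_ne s 0 with rfl | hs
    · simp [Real.zero_rpow hp0.ne']
    have hs' : 0 < |s| := abs_pos.2 hs
    have h := integral_comp_mul_left_Ioi
      (fun t : ℝ => (1 - Real.cos (1 * t)) * t ^ (-1 - p)) 0 hs'
    rw [mul_zero, smul_eq_mul] at h
    have e : ∀ t ∈ Set.Ioi (0 : ℝ), (1 - Real.cos (s * t)) * t ^ (-1 - p)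
        = |s| ^ (1 + p) * ((1 - Real.cos (1 * (|s| * t))) * (|s| * t) ^ (-1 - p)) := by
      intro t ht
      have ht0 : (0 : ℝ) < t := ht
      rw [Real.mul_rpow hs'.le ht0.le, one_mul]
      have e1 : Real.cos (|s| * t) = Real.cos (s * t) := by
        rw [← Real.cos_abs (s * t), abs_mul, abs_of_pos ht0]
      have e2 : |s| ^ (1 + p) * |s| ^ (-1 - p) = 1 := by
        rw [← Real.rpow_add hs']
        simp
      rw [e1]
      linear_combination (-(1 - Real.cos (s * t)) * t ^ (-1 - p)) * e2
    rw [setIntegral_congr_fun measurableSet_Ioi e, integral_const_mul, h, Real.rpow_add hs',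
      Real.rpow_one]
    field_simp

theorem lk_abs_rpow_CN (p : ℝ) (hp0 : 0 < p) (hp2 : p ≤ 2) (n : ℕ) (y c : Fin n → ℝ)
    (hc : ∑ j, c j = 0) : ∑ j, ∑ k, c j * c k * |y k - y j| ^ p ≤ 0 := by
  rcases hp2.eq_or_lt with rfl | hp2
  · have e : ∑ j, ∑ k, c j * c k * |y k - y j| ^ (2 : ℝ) = -2 * (∑ j, c j * y j) ^ 2 := by
      have e1 : ∀ j k, c j * c k * |y k - y j| ^ (2 : ℝ)
          = c j * (c k * y k ^ 2) - 2 * ((c j * y j) * (c k * y k)) + (c j * y j ^ 2) * c k := by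
        intro j k
        rw [Real.rpow_two, sq_abs]
        ring
      simp only [e1, Finset.sum_add_distrib, Finset.sum_sub_distrib, ← Finset.mul_sum,
        ← Finset.sum_mul, hc]
      ring
    rw [e]
    nlinarith [sq_nonneg (∑ j, c j * y j)]
  · obtain ⟨C, hC, h⟩ := lk_cos_const p hp0 hp2
    have key : C * ∑ j, ∑ k, c j * c k * |y k - y j| ^ p ≤ 0 := by
      have e : C * ∑ j, ∑ k, c j * c k * |y k - y j| ^ p
          = ∫ t in Set.Ioi (0 : ℝ), ∑ j, ∑ k,
              c j * c k * ((1 - Real.cos ((y k - y j) * t)) * t ^ (-1 - p)) := by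
        rw [integral_finsetSum]
        · rw [Finset.mul_sum]
          refine Finset.sum_congr rfl fun j _ => ?_
          rw [integral_finsetSum]
          · rw [Finset.mul_sum]
            refine Finset.sum_congr rfl fun k _ => ?_
            rw [integral_const_mul, h]
            ring
          · intro k _
            exact (lk_cos_integrable p hp0 hp2 _).const_mul _
        · intro j _
          exact integrable_finsetSum _ fun k _ => (lk_cos_integrable p hp0 hp2 _).const_mul _
      rw [e]
      refine setIntegral_nonpos measurableSet_Ioi fun t ht => ?_
      have e1 : ∑ j, ∑ k, c j * c k * ((1 - Real.cos ((y k - y j) * t)) * t ^ (-1 - p))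
          = -((∑ j, c j * Real.cos (y j * t)) ^ 2 + (∑ j, c j * Real.sin (y j * t)) ^ 2)
            * t ^ (-1 - p) := by
        have e2 : ∀ j k, c j * c k * ((1 - Real.cos ((y k - y j) * t)) * t ^ (-1 - p))
          = (c j * c k - (c j * Real.cos (y j * t)) * (c k * Real.cos (y k * t))
              - (c j * Real.sin (y j * t)) * (c k * Real.sin (y k * t))) * t ^ (-1 - p) := by
          intro j k
          rw [sub_mul (y k) (y j) t, Real.cos_sub]
          ring
        simp only [e2, ← Finset.sum_mul, Finset.sum_sub_distrib, ← Finset.mul_sum, hc]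
        ring
      rw [e1]
      have := Real.rpow_nonneg (le_of_lt ht) (-1 - p)
      apply mul_nonpos_of_nonpos_of_nonneg _ this
      have h1 := sq_nonneg (∑ j, c j * Real.cos (y j * t))
      have h2 := sq_nonneg (∑ j, c j * Real.sin (y j * t))
      linarith
    by_contra hcon
    push Not at hcon
    nlinarith [mul_pos hC hcon]

theorem lk_lpp_CN (p : ℝ) (hp0 : 0 < p) (hp2 : p ≤ 2) (n : ℕ) (x : Fin n → ℕ →₀ ℝ) (c : Fin n → ℝ)
    (hc : ∑ j, c j = 0) : ∑ j, ∑ k, c j * c k * lppFinsupp p (x k - x j) ≤ 0 := by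
  classical
  let S : Finset ℕ := Finset.univ.biUnion fun i => (x i).support
  have hxsupp : ∀ j k, (x k - x j).support ⊆ S := by
    intro j k n hn
    simp only [S, Finset.mem_biUnion, Finset.mem_univ, true_and]
    by_contra hcon
    push Not at hcon
    apply (Finsupp.mem_support_iff.1 hn)
    have h1 := Finsupp.notMem_support_iff.1 (hcon j)
    have h2 := Finsupp.notMem_support_iff.1 (hcon k)
    simp [h1, h2]
  have e : ∑ j, ∑ k, c j * c k * lppFinsupp p (x k - x j)
      = ∑ i ∈ S, ∑ j, ∑ k, c j * c k * |x k i - x j i| ^ p := by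
    rw [Finset.sum_comm (s := S)]
    refine Finset.sum_congr rfl fun j _ => ?_
    rw [Finset.sum_comm (s := S)]
    refine Finset.sum_congr rfl fun k _ => ?_
    rw [lk_lpp_eq_sum hp0 _ S (hxsupp j k), Finset.mul_sum]
    rfl
  rw [e]
  exact Finset.sum_nonpos fun i _ => lk_abs_rpow_CN p hp0 hp2 n (fun k => x k i) c hc

open Matrix in
theorem lk_psd_exp (n : ℕ) (A : Matrix (Fin n) (Fin n) ℝ) (hA : A.PosSemidef) (c : Fin n → ℝ) :
    0 ≤ ∑ j, ∑ k, c j * c k * Real.exp (A j k) := by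
  have hone : (Matrix.of fun _ _ => (1 : ℝ) : Matrix (Fin n) (Fin n) ℝ).PosSemidef := by
    refine Matrix.PosSemidef.of_dotProduct_mulVec_nonneg ?_ ?_
    · ext i j; simp
    · intro x
      have : star x ⬝ᵥ ((Matrix.of fun _ _ => (1 : ℝ) : Matrix (Fin n) (Fin n) ℝ) *ᵥ x)
          = (∑ j, x j) * (∑ j, x j) := by
        simp [dotProduct, mulVec, Finset.sum_mul]
      rw [this]
      exact mul_self_nonneg _
  have hpow : ∀ (B : Matrix (Fin n) (Fin n) ℝ), B.PosSemidef → ∀ m : ℕ,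
      (Matrix.of fun j k => (B j k) ^ m : Matrix (Fin n) (Fin n) ℝ).PosSemidef := by
    intro B hB m
    induction m with
    | zero => simpa using hone
    | succ m ih =>
      have := ih.hadamard hB
      have heq : (Matrix.of fun j k => (B j k) ^ (m + 1) : Matrix (Fin n) (Fin n) ℝ)
          = (Matrix.of fun j k => (B j k) ^ m : Matrix (Fin n) (Fin n) ℝ) ⊙ B := by
        ext j k
        simp [pow_succ]
      rw [heq]
      exact this
  have hq : ∀ m : ℕ, 0 ≤ ∑ j, ∑ k, c j * c k * (1 + A j k / m) ^ m := by
    intro m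
    let B : Matrix (Fin n) (Fin n) ℝ :=
      (Matrix.of fun _ _ => (1 : ℝ) : Matrix (Fin n) (Fin n) ℝ) + ((m : ℝ)⁻¹) • A
    have hB : ∀ j k, B j k = 1 + A j k / m := by
      intro j k
      simp [B, div_eq_inv_mul]
    have h1 : B.PosSemidef := hone.add (hA.smul (by positivity))
    have h2 := (hpow _ h1 m).dotProduct_mulVec_nonneg c
    have e : star c ⬝ᵥ ((Matrix.of fun j k => (B j k) ^ m : Matrix (Fin n) (Fin n) ℝ) *ᵥ c) = ∑ j, ∑ k, c j * c k * (1 + A j k / m) ^ m := by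
      simp only [dotProduct, mulVec, Finset.mul_sum, Matrix.of_apply, hB]
      refine Finset.sum_congr rfl fun j _ => Finset.sum_congr rfl fun k _ => ?_
      simp only [Pi.star_apply, star_trivial]
      ring
    rw [e] at h2
    exact h2
  have hlim : Tendsto (fun m : ℕ => ∑ j, ∑ k, c j * c k * (1 + A j k / m) ^ m) atTop
      (𝓝 (∑ j, ∑ k, c j * c k * Real.exp (A j k))) := by
    refine tendsto_finsetSum _ fun j _ => tendsto_finsetSum _ fun k _ => ?_
    exact (Real.tendsto_one_add_div_pow_exp (A j k)).const_mul _
  exact ge_of_tendsto' hlim hq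

theorem lk_exp_PD (p : ℝ) (hp0 : 0 < p) (hp2 : p ≤ 2) (t : ℝ) (ht : 0 ≤ t)
    (n : ℕ) (x : Fin n → ℕ →₀ ℝ) (c : Fin n → ℝ) :
    0 ≤ ∑ j, ∑ k, c j * c k * Real.exp (-t * lppFinsupp p (x k - x j)) := by
  let A : Matrix (Fin n) (Fin n) ℝ := Matrix.of fun j k =>
    t * (lppFinsupp p (x j) + lppFinsupp p (x k) - lppFinsupp p (x k - x j))
  have hA : A.PosSemidef := by
    refine Matrix.PosSemidef.of_dotProduct_mulVec_nonneg ?_ ?_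
    · ext i j
      simp only [A, Matrix.conjTranspose_apply, Matrix.of_apply, star_trivial]
      rw [← lk_lpp_neg p (x i - x j), neg_sub]
      ring
    · intro d
      have h := lk_lpp_CN p hp0 hp2 (n + 1) (Fin.cons 0 x) (Fin.cons (-∑ j, d j) d) (by
        rw [Fin.sum_univ_succ]; simp)
      simp only [Fin.sum_univ_succ, Fin.cons_zero, Fin.cons_succ, sub_zero, zero_sub, lk_lpp_neg,
        lk_lpp_zero, mul_zero, zero_add] at h
      have e2 : ∀ T : ℝ, ∑ i, -T * d i * lppFinsupp p (x i)
          = -(T * ∑ i, d i * lppFinsupp p (x i)) := by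
        intro T
        rw [Finset.mul_sum, ← Finset.sum_neg_distrib]
        exact Finset.sum_congr rfl fun i _ => by ring
      have e3 : ∀ T : ℝ, ∑ i, d i * -T * lppFinsupp p (x i)
          = -(T * ∑ i, d i * lppFinsupp p (x i)) := by
        intro T
        rw [Finset.mul_sum, ← Finset.sum_neg_distrib]
        exact Finset.sum_congr rfl fun i _ => by ring
      rw [Finset.sum_add_distrib, e2, e3] at h
      have e1 : ∀ j k, star d j * (A j k * d k) = t * ((d j * lppFinsupp p (x j)) * d k
            + d j * (d k * lppFinsupp p (x k)) - d j * d k * lppFinsupp p (x k - x j)) := by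
        intro j k
        simp only [Pi.star_apply, star_trivial, A, Matrix.of_apply]
        ring
      have e : star d ⬝ᵥ (Matrix.mulVec A d) = t * ((∑ i, d i * lppFinsupp p (x i)) * (∑ j, d j)
          + (∑ j, d j) * (∑ i, d i * lppFinsupp p (x i))
          - ∑ j, ∑ k, d j * d k * lppFinsupp p (x k - x j)) := by
        have e0 : star d ⬝ᵥ (Matrix.mulVec A d) = ∑ j, ∑ k, star d j * (A j k * d k) := by
          simp only [dotProduct, Matrix.mulVec, Finset.mul_sum]
        rw [e0]
        simp only [e1]
        simp only [← Finset.mul_sum, Finset.sum_add_distrib, Finset.sum_sub_distrib,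
          ← Finset.sum_mul]
      rw [e]
      exact mul_nonneg ht (by nlinarith)
  have h := lk_psd_exp n A hA (fun j => c j * Real.exp (-t * lppFinsupp p (x j)))
  refine h.trans_eq ?_
  refine Finset.sum_congr rfl fun j _ => Finset.sum_congr rfl fun k _ => ?_
  have : Real.exp (-t * lppFinsupp p (x k - x j)) = Real.exp (-t * lppFinsupp p (x j))
      * Real.exp (-t * lppFinsupp p (x k)) * Real.exp (A j k) := by
    rw [← Real.exp_add, ← Real.exp_add]
    congr 1
    simp only [A, Matrix.of_apply]
    ring
  rw [this]
  ring

theorem lk_one_sub_exp_CN (p : ℝ) (hp0 : 0 < p) (hp2 : p ≤ 2) (t : ℝ) (ht : 0 ≤ t)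
    (n : ℕ) (x : Fin n → ℕ →₀ ℝ) (c : Fin n → ℝ) (hc : ∑ j, c j = 0) :
    ∑ j, ∑ k, c j * c k * (1 - Real.exp (-t * lppFinsupp p (x k - x j))) ≤ 0 := by
  have h := lk_exp_PD p hp0 hp2 t ht n x c
  simp only [mul_sub, mul_one, Finset.sum_sub_distrib, ← Finset.mul_sum, hc]
  simpa using h

theorem lk_indicator_CN (p : ℝ) (hp0 : 0 < p) (hp2 : p ≤ 2) (b : ℝ) (hb : 0 ≤ b)
    (n : ℕ) (x : Fin n → ℕ →₀ ℝ) (c : Fin n → ℝ) (hc : ∑ j, c j = 0) :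
    ∑ j, ∑ k, c j * c k * Set.indicator ({0}ᶜ : Set (ℕ →₀ ℝ)) (fun _ => b) (x k - x j) ≤ 0 := by
  have hlim : Tendsto (fun m : ℕ => b * ∑ j, ∑ k, c j * c k *
      (1 - Real.exp (-(m : ℝ) * lppFinsupp p (x k - x j)))) atTop
      (𝓝 (∑ j, ∑ k, c j * c k * Set.indicator ({0}ᶜ : Set (ℕ →₀ ℝ)) (fun _ => b) (x k - x j))) := by
    simp only [Finset.mul_sum]
    refine tendsto_finsetSum _ fun j _ => tendsto_finsetSum _ fun k _ => ?_
    by_cases h0 : x k - x j = 0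
    · simp [h0, lk_lpp_zero]
    · have hpos := lk_lpp_pos (p := p) _ h0
      rw [Set.indicator_of_mem (by simpa using h0)]
      have h1 : Tendsto (fun m : ℕ => Real.exp (-(m : ℝ) * lppFinsupp p (x k - x j))) atTop (𝓝 0) := by
        have : Tendsto (fun m : ℕ => (m : ℝ) * lppFinsupp p (x k - x j)) atTop atTop :=
          tendsto_natCast_atTop_atTop.atTop_mul_const hpos
        have h3 := Real.tendsto_exp_neg_atTop_nhds_zero.comp this
        refine h3.congr fun m => ?_
        simp only [Function.comp, neg_mul]
      have h2 := ((tendsto_const_nhds (x := (1 : ℝ))).sub h1).const_mul (c j * c k) |>.const_mul b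
      convert h2 using 2
      ring
  refine le_of_tendsto' hlim fun m => ?_
  exact mul_nonpos_of_nonneg_of_nonpos hb (lk_one_sub_exp_CN p hp0 hp2 m (by positivity) n x c hc)

theorem lk_indicator_eq (p b : ℝ) (r : ℕ →₀ ℝ) :
    Set.indicator ({0}ᶜ : Set (ℕ →₀ ℝ)) (fun _ => b) r
      = if lppFinsupp p r = 0 then 0 else b := by
  by_cases h0 : r = 0
  · subst h0
    simp [lk_lpp_zero]
  · rw [Set.indicator_of_mem (by simpa using h0), if_neg (lk_lpp_pos r h0).ne']

/-- Lévy–Khintchine formula on `ℝ^{(ℕ)}`: a radial (w.r.t. `‖·‖_p^p`, `0 < p ≤ 2`)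
function `ψ` with `ψ(0) = 0` is conditionally negative definite and bounded below iff
`ψ(r) = c‖r‖_p^p + b·χ_{ℝ^{(ℕ)}∖{0}}(r) + ∫_0^∞ (1 − e^{−t‖r‖_p^p}) dν(t)` for some
`b, c ≥ 0` and a positive Borel measure `ν` on `(0,∞)` with `∫_0^∞ (1 − e^{−t}) dν < ∞`;
moreover `b`, `c`, `ν` are then uniquely determined by `ψ`. -/
theorem condNegDef_iff_levyKhintchine_lppFinsupp
    (p : ℝ) (hp0 : 0 < p) (hp2 : p ≤ 2)
    (ψ : (ℕ →₀ ℝ) → ℝ)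
    (hrad : ∃ ψdot : ℝ → ℝ, ∀ r : ℕ →₀ ℝ, ψ r = ψdot (lppFinsupp p r))
    (hzero : ψ 0 = 0) :
    ((IsCondNegDefAdd ψ ∧ BddBelow (Set.range ψ)) ↔
      ∃ (b c : ℝ) (ν : Measure (Set.Ioi (0 : ℝ))), 0 ≤ b ∧ 0 ≤ c ∧
        (∫⁻ t : Set.Ioi (0 : ℝ), ENNReal.ofReal (1 - Real.exp (-(t : ℝ))) ∂ν) < ⊤ ∧
        ∀ r : ℕ →₀ ℝ,
          ψ r = c * lppFinsupp p r
            + Set.indicator ({0}ᶜ : Set (ℕ →₀ ℝ)) (fun _ => b) r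
            + ∫ t : Set.Ioi (0 : ℝ), (1 - Real.exp (-(t : ℝ) * lppFinsupp p r)) ∂ν) ∧
    ∀ (b₁ c₁ : ℝ) (ν₁ : Measure (Set.Ioi (0 : ℝ))) (b₂ c₂ : ℝ)
        (ν₂ : Measure (Set.Ioi (0 : ℝ))),
      0 ≤ b₁ → 0 ≤ c₁ →
      (∫⁻ t : Set.Ioi (0 : ℝ), ENNReal.ofReal (1 - Real.exp (-(t : ℝ))) ∂ν₁) < ⊤ →
      0 ≤ b₂ → 0 ≤ c₂ →
      (∫⁻ t : Set.Ioi (0 : ℝ), ENNReal.ofReal (1 - Real.exp (-(t : ℝ))) ∂ν₂) < ⊤ →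
      (∀ r : ℕ →₀ ℝ,
        ψ r = c₁ * lppFinsupp p r
          + Set.indicator ({0}ᶜ : Set (ℕ →₀ ℝ)) (fun _ => b₁) r
          + ∫ t : Set.Ioi (0 : ℝ), (1 - Real.exp (-(t : ℝ) * lppFinsupp p r)) ∂ν₁) →
      (∀ r : ℕ →₀ ℝ,
        ψ r = c₂ * lppFinsupp p r
          + Set.indicator ({0}ᶜ : Set (ℕ →₀ ℝ)) (fun _ => b₂) r
          + ∫ t : Set.Ioi (0 : ℝ), (1 - Real.exp (-(t : ℝ) * lppFinsupp p r)) ∂ν₂) →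
      b₁ = b₂ ∧ c₁ = c₂ ∧ ν₁ = ν₂ := by
  obtain ⟨g, hg⟩ := hrad
  have hg0 : g 0 = 0 := by
    have := hg 0
    rw [lk_lpp_zero, hzero] at this
    exact this.symm
  refine ⟨⟨?_, ?_⟩, ?_⟩
  · rintro ⟨h, -⟩
    obtain ⟨μ, hμ, hrep⟩ := lk_rep g hg0 (lk_mono hp0 hg h) (lk_CM hp0 hg h)
    obtain ⟨b, c, ν, hb, hc, hν, hf⟩ := lk_exists_triple μ
    refine ⟨b, c, ν, hb, hc, hν, fun r => ?_⟩
    rw [hg r, hrep _ (lk_lpp_nonneg p r), hf _ (lk_lpp_nonneg p r), lk_indicator_eq p b r]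
  · rintro ⟨b, c, ν, hb, hc, hν, hf⟩
    constructor
    · refine lk_CND_of_real ψ (fun r => by rw [hg, hg, lk_lpp_neg]) fun n x d hd => ?_
      have h1 := lk_lpp_CN p hp0 hp2 n x d hd
      have h2 := lk_indicator_CN p hp0 hp2 b hb n x d hd
      have hi : ∀ r : ℕ →₀ ℝ, Integrable
          (fun t : Set.Ioi (0 : ℝ) => 1 - Real.exp (-(t : ℝ) * lppFinsupp p r)) ν :=
        fun r => lk_integrable ν hν _ (lk_lpp_nonneg p r)
      have h3 : ∑ j, ∑ k, d j * d k *
          ∫ t : Set.Ioi (0 : ℝ), (1 - Real.exp (-(t : ℝ) * lppFinsupp p (x k - x j))) ∂ν ≤ 0 := by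
        have e : ∑ j, ∑ k, d j * d k *
            ∫ t : Set.Ioi (0 : ℝ), (1 - Real.exp (-(t : ℝ) * lppFinsupp p (x k - x j))) ∂ν
            = ∫ t : Set.Ioi (0 : ℝ), ∑ j, ∑ k, d j * d k *
              (1 - Real.exp (-(t : ℝ) * lppFinsupp p (x k - x j))) ∂ν := by
          rw [integral_finsetSum]
          · refine Finset.sum_congr rfl fun j _ => ?_
            rw [integral_finsetSum]
            · refine Finset.sum_congr rfl fun k _ => ?_
              rw [integral_const_mul]
            · intro k _
              exact (hi _).const_mul _
          · intro j _
            exact integrable_finsetSum _ fun k _ => (hi _).const_mul _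
        rw [e]
        exact integral_nonpos fun t =>
          lk_one_sub_exp_CN p hp0 hp2 t (le_of_lt t.2) n x d hd
      have e : ∑ j, ∑ k, d j * d k * ψ (x k - x j) =
          c * (∑ j, ∑ k, d j * d k * lppFinsupp p (x k - x j))
          + (∑ j, ∑ k, d j * d k * Set.indicator ({0}ᶜ : Set (ℕ →₀ ℝ)) (fun _ => b) (x k - x j))
          + ∑ j, ∑ k, d j * d k *
          ∫ t : Set.Ioi (0 : ℝ), (1 - Real.exp (-(t : ℝ) * lppFinsupp p (x k - x j))) ∂ν := by
        simp only [Finset.mul_sum, ← Finset.sum_add_distrib]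
        refine Finset.sum_congr rfl fun j _ => Finset.sum_congr rfl fun k _ => ?_
        rw [hf]
        ring
      rw [e]
      have := mul_nonpos_of_nonneg_of_nonpos hc h1
      linarith
    · refine ⟨0, ?_⟩
      rintro _ ⟨r, rfl⟩
      rw [hf r, lk_indicator_eq p b r]
      have hN := lk_lpp_nonneg p r
      refine add_nonneg (add_nonneg (mul_nonneg hc hN) ?_) ?_
      · split_ifs
        · exact le_rfl
        · exact hb
      · refine integral_nonneg fun t => ?_
        have ht : (0 : ℝ) < t := t.2
        have : Real.exp (-(t : ℝ) * lppFinsupp p r) ≤ 1 := by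
          rw [Real.exp_le_one_iff]
          nlinarith [mul_nonneg ht.le hN]
        simp only [Pi.zero_apply]
        linarith
  · intro b₁ c₁ ν₁ b₂ c₂ ν₂ hb₁ hc₁ hν₁ hb₂ hc₂ hν₂ h₁ h₂
    have key : ∀ (b c : ℝ) (ν : Measure (Set.Ioi (0 : ℝ))), (∀ r : ℕ →₀ ℝ,
        ψ r = c * lppFinsupp p r
          + Set.indicator ({0}ᶜ : Set (ℕ →₀ ℝ)) (fun _ => b) r
          + ∫ t : Set.Ioi (0 : ℝ), (1 - Real.exp (-(t : ℝ) * lppFinsupp p r)) ∂ν) →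
        ∀ s : ℝ, 0 ≤ s → c * s + (if s = 0 then 0 else b)
          + ∫ t : Set.Ioi (0 : ℝ), (1 - Real.exp (-(t : ℝ) * s)) ∂ν = g s := by
      intro b c ν h s hs
      have h1 := h (Finsupp.single 0 (s ^ p⁻¹))
      rw [lk_indicator_eq p, hg, lk_lpp_single hp0 0 s hs] at h1
      exact h1.symm
    have mom : ∀ (b c : ℝ) (ν : Measure (Set.Ioi (0 : ℝ))), 0 ≤ b → 0 ≤ c →
        (∫⁻ t : Set.Ioi (0 : ℝ), ENNReal.ofReal (1 - Real.exp (-(t : ℝ))) ∂ν) < ⊤ →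
        (∀ r : ℕ →₀ ℝ, ψ r = c * lppFinsupp p r
          + Set.indicator ({0}ᶜ : Set (ℕ →₀ ℝ)) (fun _ => b) r
          + ∫ t : Set.Ioi (0 : ℝ), (1 - Real.exp (-(t : ℝ) * lppFinsupp p r)) ∂ν) →
        ∀ n : ℕ, ∫ y : unitInterval, (y : ℝ) ^ n ∂(lkMu b c ν) = g (n + 1) - g n := by
      intro b c ν hb hc hν h n
      have hn : (0 : ℝ) < (n : ℝ) + 1 := by positivity
      have k1 := key b c ν h ((n : ℝ) + 1) hn.le
      have k2 := key b c ν h (n : ℝ) (by positivity)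
      rw [if_neg hn.ne'] at k1
      rw [lkMu_moment b c hb hc ν hν n, k1, k2]
    have := lkMu_finite b₁ c₁ ν₁ hν₁
    have := lkMu_finite b₂ c₂ ν₂ hν₂
    exact lkMu_inj b₁ c₁ ν₁ b₂ c₂ ν₂ hb₁ hc₁ hb₂ hc₂
      (lk_moment_unique _ _ fun n => by
        rw [mom b₁ c₁ ν₁ hb₁ hc₁ hν₁ h₁ n, mom b₂ c₂ ν₂ hb₂ hc₂ hν₂ h₂ n])
end
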